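/- arXiv:1801.04024 — 2 statements merged into one kernel-verified Lean document; each statement's English description precedes it below -/
import Mathlib

section
/- Every countable ICC group admits a continuous action on a nonempty compact metrizable space that is faithful, minimal, and proximal. -/
/-- A continuous action of `G` on a topological space `X` is proximal if for all `x, y ∈ X`
the closure of `{(g • x, g • y) : g ∈ G}` in `X × X` meets the diagonal. -/
def IsProximalAction (G X : Type*) [Group G] [MulAction G X] [TopologicalSpace X] : Prop :=
  ∀ x y : X, ∃ z : X, (z, z) ∈ closure {p : X × X | ∃ g : G, p = (g • x, g • y)}

/-- A group is ICC if it is nontrivial and every non-identity element has an infinite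
conjugacy class. -/
def IsICC (G : Type*) [Group G] : Prop :=
  Nontrivial G ∧ ∀ g : G, g ≠ 1 → {h : G | IsConj g h}.Infinite

open scoped Pointwise

/-- A set `T` is `E`-separated if distinct elements `x`, `y` of `T` satisfy `x * y⁻¹ ∉ E`. -/
def SepBy {G : Type} [Group G] (E T : Set G) : Prop :=
  ∀ x ∈ T, ∀ y ∈ T, x * y⁻¹ ∈ E → x = y

section Combinatorics

variable {G : Type} [Group G]

/-- A separated subset of `Q` extends to a maximal one, which is then relatively dense in `Q`. -/
theorem SepBy.exists_maximal {V T Q : Set G} (hT : SepBy V T) (hTQ : T ⊆ Q) (h1 : (1 : G) ∈ V)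
    (hinv : ∀ v ∈ V, v⁻¹ ∈ V) :
    ∃ S, T ⊆ S ∧ S ⊆ Q ∧ SepBy V S ∧ ∀ b ∈ Q, ∃ v ∈ V, v * b ∈ S := by
  obtain ⟨S, hTS, hS⟩ := zorn_subset_nonempty {S : Set G | S ⊆ Q ∧ SepBy V S} (by
    intro c hc hchain _
    refine ⟨⋃₀ c, ⟨Set.sUnion_subset fun s hs => (hc hs).1, ?_⟩,
      fun s hs => Set.subset_sUnion_of_mem hs⟩
    rintro x ⟨s, hs, hxs⟩ y ⟨t, ht, hyt⟩ hxy
    rcases hchain.total hs ht with h | h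
    · exact (hc ht).2 x (h hxs) y hyt hxy
    · exact (hc hs).2 x hxs y (h hyt) hxy) T ⟨hTQ, hT⟩
  refine ⟨S, hTS, hS.prop.1, hS.prop.2, fun b hb => ?_⟩
  by_contra! hcon
  have hsub : insert b S ⊆ S := hS.le_of_ge (y := insert b S)
    ⟨Set.insert_subset hb hS.prop.1, by
      rintro x (rfl | hx) y (rfl | hy) hxy
      · rfl
      · refine absurd hy ?_
        simpa using hcon _ (hinv _ hxy)
      · refine absurd hx ?_
        simpa using hcon _ hxy
      · exact hS.prop.2 x hx y hy hxy⟩ (Set.subset_insert b S)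
  exact hcon 1 h1 (by simpa using hsub (Set.mem_insert b S))

/-- Restriction along an injection preserves the proportion of Boolean functions satisfying a
given property. -/
theorem card_comp_injective_mul {α Ω : Type} [Finite α] [Finite Ω] (i : α → Ω)
    (hi : Function.Injective i) (Q : Set (α → Bool)) :
    {ω : Ω → Bool | ω ∘ i ∈ Q}.ncard * 2 ^ Nat.card α = Q.ncard * 2 ^ Nat.card Ω := by
  classical
  let β := ((Set.range i)ᶜ : Set Ω)
  let e : α ⊕ β ≃ Ω :=
    ((Equiv.ofInjective i hi).sumCongr (Equiv.refl _)).trans (Equiv.Set.sumCompl (Set.range i))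
  have he : ∀ a, e (Sum.inl a) = i a := fun a => rfl
  let φ : (Ω → Bool) ≃ (α → Bool) × (β → Bool) :=
    (e.symm.arrowCongr (Equiv.refl Bool)).trans (Equiv.sumArrowEquivProdArrow α β Bool)
  have hφ : ∀ ω, (φ ω).1 = ω ∘ i := by
    intro ω
    funext a
    simp [φ, he]
  have h1 : {ω : Ω → Bool | ω ∘ i ∈ Q}.ncard = (Q ×ˢ (Set.univ : Set (β → Bool))).ncard := by
    rw [← Set.ncard_image_of_injective _ φ.injective]
    congr 1
    ext q
    constructor
    · rintro ⟨ω, hω, rfl⟩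
      exact ⟨by rw [hφ]; exact hω, trivial⟩
    · rintro ⟨hq, -⟩
      exact ⟨φ.symm q, by simpa [← hφ] using hq, by simp⟩
  have h2 : Nat.card Ω = Nat.card α + Nat.card β := by
    rw [← Nat.card_congr e, Nat.card_sum]
  rw [h1, Set.ncard_prod, Set.ncard_univ, Nat.card_fun, h2, pow_add]
  simp
  ring

theorem ncard_forall_ne {α β : Type} [Finite α] [Finite β] (s : β → Bool) :
    {q : α × β → Bool | ∀ a, (fun b => q (a, b)) ≠ s}.ncard =
      (2 ^ Nat.card β - 1) ^ Nat.card α := by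
  classical
  have : Fintype β := Fintype.ofFinite β
  have : Fintype α := Fintype.ofFinite α
  let e : {q : α × β → Bool | ∀ a, (fun b => q (a, b)) ≠ s} ≃
      (α → {f : β → Bool // f ≠ s}) :=
    { toFun := fun q a => ⟨fun b => q.1 (a, b), q.2 a⟩
      invFun := fun f => ⟨fun ab => (f ab.1).1 ab.2, fun a => (f a).2⟩
      left_inv := fun q => rfl
      right_inv := fun f => rfl }
  rw [← Nat.card_coe_set_eq, Nat.card_congr e, Nat.card_fun]
  simp [Fintype.card_subtype_compl, Nat.card_eq_fintype_card]

theorem exists_sq_mul_pow_lt (m : ℕ) (hm : 0 < m) :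
    ∃ n : ℕ, 0 < n ∧ n ^ 2 * m * (2 ^ m - 1) ^ n < 2 ^ (n * m) := by
  have h2 : (0 : ℝ) < 2 ^ m := by positivity
  set r : ℝ := (2 ^ m - 1) / 2 ^ m with hr
  have hr0 : 0 ≤ r := div_nonneg (by linarith [one_le_pow₀ (M₀ := ℝ) one_le_two (n := m)]) h2.le
  have hr1 : r < 1 := by rw [hr, div_lt_one h2]; linarith
  have ht := tendsto_pow_const_mul_const_pow_of_abs_lt_one 2 (r := r)
    (by rwa [abs_of_nonneg hr0])
  have hmr : (0 : ℝ) < 1 / m := by positivity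
  obtain ⟨n, hn, hn0⟩ := ((ht.eventually_lt_const hmr).and (Filter.eventually_gt_atTop 0)).exists
  refine ⟨n, hn0, ?_⟩
  have hm' : (0 : ℝ) < m := by exact_mod_cast hm
  rw [lt_div_iff₀ hm', hr, div_pow] at hn
  have h3 : (n : ℝ) ^ 2 * m * (2 ^ m - 1) ^ n < 2 ^ (n * m) := by
    have : (2 : ℝ) ^ (n * m) = (2 ^ m) ^ n := by rw [← pow_mul, mul_comm]
    rw [this]
    have h4 : (0 : ℝ) < (2 ^ m) ^ n := by positivity
    have := mul_lt_mul_of_pos_right hn h4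
    rw [one_mul] at this
    calc (n : ℝ) ^ 2 * m * (2 ^ m - 1) ^ n
        = (n : ℝ) ^ 2 * ((2 ^ m - 1) ^ n / (2 ^ m) ^ n) * m * (2 ^ m) ^ n := by
          field_simp
      _ < _ := this
  have h5 : ((2 ^ m - 1 : ℕ) : ℝ) = 2 ^ m - 1 := by
    rw [Nat.cast_sub Nat.one_le_two_pow]; simp
  rw [← h5] at h3
  exact_mod_cast h3

/-- An infinite group contains arbitrarily long `E`-separated sequences starting at `1`. -/
theorem exists_separated_seq [Infinite G] {E : Set G} (hE : E.Finite) :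
    ∃ p : ℕ → G, p 0 = 1 ∧ ∀ i j, p i * (p j)⁻¹ ∈ E → i = j := by
  obtain ⟨p, -, hp⟩ := exists_seq_of_forall_finset_exists (fun _ : G => True)
    (fun x y => y * x⁻¹ ∉ E ∧ x * y⁻¹ ∉ E) (by
      intro s _
      have hfin : (E * (s : Set G) ∪ E⁻¹ * (s : Set G)).Finite :=
        (hE.mul s.finite_toSet).union (hE.inv.mul s.finite_toSet)
      obtain ⟨y, hy⟩ := hfin.exists_notMem
      refine ⟨y, trivial, fun x hx => ⟨fun h => hy (Or.inl ?_), fun h => hy (Or.inr ?_)⟩⟩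
      · exact ⟨_, h, x, hx, by simp⟩
      · exact ⟨y * x⁻¹, by simpa using h, x, hx, by simp⟩)
  refine ⟨fun i => p i * (p 0)⁻¹, by simp, fun i j hij => ?_⟩
  have hij' : p i * (p j)⁻¹ ∈ E := by simpa [mul_assoc] using hij
  rcases lt_trichotomy i j with h | h | h
  · exact absurd hij' (hp i j h).2
  · exact h
  · exact absurd hij' (hp j i h).1

/-- For a finite set `E` there are finite `E`-separated sets `P` and `R` such that `R` meets all
the translates `P * v` with `v ∈ P⁻¹ * E * P`. -/
theorem exists_sepBy_hitting [Infinite G] {E : Set G} (hE : E.Finite) (h1 : (1 : G) ∈ E) :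
    ∃ P R : Set G, P.Finite ∧ R.Finite ∧ (1 : G) ∈ P ∧ SepBy E P ∧ SepBy E R ∧
      ∀ v ∈ P⁻¹ * E * P, ∃ p ∈ P, p * v ∈ R := by
  classical
  have : Finite E := hE
  have hcard : 0 < Nat.card E := Nat.card_pos_iff.2 ⟨⟨1, h1⟩, this⟩
  obtain ⟨n, hn, hlt⟩ := exists_sq_mul_pow_lt (Nat.card E) hcard
  obtain ⟨p, hp0, hp⟩ := exists_separated_seq (hE.inv.mul hE)
  set P : Set G := p '' Set.Iio n with hP
  have hPfin : P.Finite := (Set.finite_Iio n).image p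
  have hPcard : P.ncard ≤ n := by
    simpa using Set.ncard_image_le (f := p) (Set.finite_Iio n)
  set V : Set G := P⁻¹ * E * P with hV
  have hVfin : V.Finite := (hPfin.inv.mul hE).mul hPfin
  have hVcard : V.ncard ≤ n ^ 2 * Nat.card E := by
    calc V.ncard ≤ (P⁻¹ * E).ncard * P.ncard := Set.natCard_mul_le
      _ ≤ (P⁻¹.ncard * E.ncard) * P.ncard := Nat.mul_le_mul_right _ Set.natCard_mul_le
      _ = (P.ncard * E.ncard) * P.ncard := by rw [Set.ncard_inv]
      _ ≤ (n * E.ncard) * n := by gcongr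
      _ = _ := by rw [Nat.card_coe_set_eq]; ring
  set K : Set G := E * P * V with hK
  have hKfin : K.Finite := (hE.mul hPfin).mul hVfin
  have : Finite K := hKfin
  have hmem : ∀ (i : Fin n) (e : E) (v : G), v ∈ V → e * p i * v ∈ K := fun i e v hv =>
    ⟨_, ⟨e, e.2, p i, ⟨i, i.2, rfl⟩, rfl⟩, v, hv, rfl⟩
  let s : E → Bool := fun e => decide (e = ⟨1, h1⟩)
  let bad : G → Set (K → Bool) := fun v =>
    {ω | ∀ hv : v ∈ V, ∀ i : Fin n, (fun e : E => ω ⟨e * p i * v, hmem i e v hv⟩) ≠ s}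
  have hbad : ∀ v ∈ V, (bad v).ncard * 2 ^ (n * Nat.card E) =
      (2 ^ Nat.card E - 1) ^ n * 2 ^ Nat.card K := by
    intro v hv
    have := card_comp_injective_mul (α := Fin n × E) (Ω := K)
      (fun ie => ⟨ie.2 * p ie.1 * v, hmem ie.1 ie.2 v hv⟩) (by
        rintro ⟨i, e⟩ ⟨j, f⟩ h
        have h' : (e : G) * p i = f * p j := by simpa using h
        have hij : i = j := by
          refine Fin.ext (hp i j ⟨(e : G)⁻¹, by simp, f, f.2, ?_⟩)
          simp only
          rw [inv_mul_eq_iff_eq_mul, ← mul_assoc, h']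
          simp
        subst hij
        simpa [Subtype.ext_iff] using h') {q | ∀ a, (fun b => q (a, b)) ≠ s}
    rw [ncard_forall_ne, Nat.card_prod, Nat.card_fin] at this
    rw [← this]
    congr 2
    ext ω
    simp [bad, hv, Function.comp_def]
  obtain ⟨ω, hω⟩ : ∃ ω : K → Bool, ∀ v ∈ V, ω ∉ bad v := by
    by_contra! hcon
    have hcov : (⋃ v ∈ hVfin.toFinset, bad v) = Set.univ := by
      refine Set.eq_univ_of_forall fun ω => ?_
      obtain ⟨v, hv, h⟩ := hcon ω
      simpa using ⟨v, hv, h⟩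
    have h2 : 2 ^ Nat.card K ≤ ∑ v ∈ hVfin.toFinset, (bad v).ncard := by
      have := Finset.set_ncard_biUnion_le hVfin.toFinset bad
      rw [hcov, Set.ncard_univ, Nat.card_fun] at this
      simpa using this
    have h3 : 2 ^ Nat.card K * 2 ^ (n * Nat.card E) ≤
        (n ^ 2 * Nat.card E * (2 ^ Nat.card E - 1) ^ n) * 2 ^ Nat.card K := by
      calc _ ≤ (∑ v ∈ hVfin.toFinset, (bad v).ncard) * 2 ^ (n * Nat.card E) := by gcongr
        _ = ∑ v ∈ hVfin.toFinset, (2 ^ Nat.card E - 1) ^ n * 2 ^ Nat.card K := by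
          rw [Finset.sum_mul]
          exact Finset.sum_congr rfl fun v hv => hbad v (by simpa using hv)
        _ = V.ncard * ((2 ^ Nat.card E - 1) ^ n * 2 ^ Nat.card K) := by
          rw [Finset.sum_const, smul_eq_mul, Set.ncard_eq_toFinset_card V hVfin]
        _ ≤ (n ^ 2 * Nat.card E) * ((2 ^ Nat.card E - 1) ^ n * 2 ^ Nat.card K) := by gcongr
        _ = _ := by ring
    rw [mul_comm (2 ^ Nat.card K)] at h3
    exact absurd (Nat.le_of_mul_le_mul_right h3 (by positivity)) (not_le.2 hlt)
  refine ⟨P, {x | ∀ e : E, ∃ h : e * x ∈ K, ω ⟨e * x, h⟩ = s e}, hPfin, ?_, ⟨0, hn, hp0⟩, ?_, ?_,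
    ?_⟩
  · refine hKfin.subset fun x hx => ?_
    obtain ⟨h, -⟩ := hx ⟨1, h1⟩
    simpa using h
  · rintro _ ⟨i, -, rfl⟩ _ ⟨j, -, rfl⟩ hij
    rw [hp i j ⟨1, by simpa using h1, _, hij, by simp⟩]
  · intro x hx y hy hxy
    by_contra hne
    obtain ⟨h, hx1⟩ := hx ⟨1, h1⟩
    obtain ⟨h', hy1⟩ := hy ⟨_, hxy⟩
    simp only [s, one_mul, decide_true, inv_mul_cancel_right] at hx1 hy1
    rw [hx1] at hy1
    exact hne (by simpa [Subtype.ext_iff, mul_inv_eq_one] using hy1)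
  · intro v hv
    have := hω v hv
    simp only [bad, Set.mem_ofPred_eq, not_forall, not_not] at this
    obtain ⟨_, i, hi⟩ := this
    refine ⟨p i, ⟨i, i.2, rfl⟩, fun e => ⟨by simpa [mul_assoc] using hmem i e v hv, ?_⟩⟩
    rw [← hi]
    simp [mul_assoc]

theorem IsICC.infinite (hG : IsICC G) : Infinite G := by
  obtain ⟨⟨a, b, hab⟩, h⟩ := hG
  by_cases ha : a = 1
  · exact Set.infinite_univ_iff.1 ((h b (by rintro rfl; exact hab ha)).mono (Set.subset_univ _))
  · exact Set.infinite_univ_iff.1 ((h a ha).mono (Set.subset_univ _))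

theorem IsICC.exists_conj_notMem (hG : IsICC G) {z : G} (hz : z ≠ 1) {V B : Set G}
    (hV : V.Finite) (hB : B.Finite) : ∃ c, c ∉ B ∧ c * z * c⁻¹ ∉ V := by
  obtain ⟨x, hx, hx'⟩ := ((hG.2 z hz).sdiff
    (hV.union (hB.image fun c => c * z * c⁻¹))).nonempty
  obtain ⟨c, rfl⟩ := isConj_iff.1 hx
  exact ⟨c, fun h => hx' (Or.inr ⟨c, h, rfl⟩), fun h => hx' (Or.inl h)⟩

/-- In an ICC group there is a finite separated set, disjoint from a given finite set, which
contains a pair `c`, `c * z` for every `z` in a given finite set of nontrivial elements. -/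
theorem IsICC.exists_sepBy_pairs (hG : IsICC G) {V X Z : Set G} (hV : V.Finite) (hX : X.Finite)
    (hZ : Z.Finite) (hinv : ∀ v ∈ V, v⁻¹ ∈ V) (hZ1 : (1 : G) ∉ Z) :
    ∃ S : Set G, S.Finite ∧ SepBy V S ∧ Disjoint S X ∧ ∀ z ∈ Z, ∃ c ∈ S, c * z ∈ S := by
  induction Z, hZ using Set.Finite.induction_on with
  | empty => exact ⟨∅, Set.finite_empty, by simp [SepBy], by simp, by simp⟩
  | @insert z Z _ _ ih =>
    simp only [Set.mem_insert_iff, not_or] at hZ1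
    obtain ⟨S, hSfin, hS, hSX, hSZ⟩ := ih hZ1.2
    have hVS := (hV.mul hSfin).union hX
    obtain ⟨c, hc, hcV⟩ := hG.exists_conj_notMem (Ne.symm hZ1.1) hV
      (hVS.union (hVS.image fun x => x * z⁻¹))
    have hfar : ∀ x, x ∉ V * S → ∀ y ∈ S, x * y⁻¹ ∉ V ∧ y * x⁻¹ ∉ V := fun x hx y hy =>
      ⟨fun h => hx ⟨_, h, y, hy, by simp⟩, fun h => hx ⟨_, hinv _ h, y, hy, by simp⟩⟩
    have hc1 : c ∉ V * S := fun h => hc (Or.inl (Or.inl h))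
    have hc2 : c * z ∉ V * S := fun h => hc (Or.inr ⟨_, Or.inl h, by simp⟩)
    refine ⟨insert c (insert (c * z) S), (hSfin.insert _).insert _, ?_, ?_, ?_⟩
    · rintro x (rfl | rfl | hx) y (rfl | rfl | hy) h
      · rfl
      · exact absurd (hinv _ h) (by simpa [mul_assoc] using hcV)
      · exact absurd h (hfar _ hc1 y hy).1
      · exact absurd h hcV
      · rfl
      · exact absurd h (hfar _ hc2 y hy).1
      · exact absurd h (hfar _ hc1 x hx).2
      · exact absurd h (hfar _ hc2 x hx).2
      · exact hS x hx y hy h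
    · rw [Set.disjoint_left] at hSX ⊢
      rintro x (rfl | rfl | hx) hxX
      · exact hc (Or.inl (Or.inr hxX))
      · exact hc (Or.inr ⟨_, Or.inr hxX, by simp⟩)
      · exact hSX hx hxX
    · rintro w (rfl | hw)
      · exact ⟨c, by simp, by simp⟩
      · obtain ⟨d, hd, hdw⟩ := hSZ w hw
        exact ⟨d, Or.inr (Or.inr hd), Or.inr (Or.inr hdw)⟩

end Combinatorics

/-- Finite sets governing the placement of `E`-separated markers: a sparse set `D` of sites
carries a copy of `R` and of `S₀` each, and the rest of the group is filled by copies of `P`. -/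
structure Template (G : Type) [Group G] (E : Set G) where
  (P R X S₀ V W : Set G)
  finite_P : P.Finite
  finite_R : R.Finite
  finite_X : X.Finite
  finite_S₀ : S₀.Finite
  finite_V : V.Finite
  finite_W : W.Finite
  one_mem_P : 1 ∈ P
  one_mem_V : 1 ∈ V
  one_mem_W : 1 ∈ W
  inv_mem_V : ∀ v ∈ V, v⁻¹ ∈ V
  inv_mem_W : ∀ w ∈ W, w⁻¹ ∈ W
  sepBy_P : SepBy E P
  sepBy_R : SepBy E R
  sepBy_S₀ : SepBy V S₀
  mem_V : ∀ p ∈ P, ∀ e ∈ E, ∀ q ∈ P, p⁻¹ * e * q ∈ V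
  hit : ∀ v ∈ V, ∃ p ∈ P, p * v ∈ R
  mem_X : ∀ p ∈ P, ∀ e ∈ E, ∀ r ∈ R, p⁻¹ * e * r ∈ X
  disjoint_S₀_X : Disjoint S₀ X
  pairs : ∀ z ∈ X, z ≠ 1 → ∃ c ∈ S₀, c * z ∈ S₀
  subset_W : E ⊆ W
  mem_W_of_R : ∀ r ∈ R, ∀ e ∈ E, ∀ r' ∈ R, r⁻¹ * e * r' ∈ W
  mem_W_of_S₀ : ∀ s ∈ S₀, ∀ v ∈ V, ∀ s' ∈ S₀, s⁻¹ * v * s' ∈ W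
  mem_W_of_X : ∀ s ∈ S₀, ∀ x ∈ X, s⁻¹ * x ∈ W

theorem IsICC.nonempty_template {G : Type} [Group G] (hG : IsICC G) {E : Set G} (hE : E.Finite)
    (h1 : (1 : G) ∈ E) (hinv : ∀ e ∈ E, e⁻¹ ∈ E) : Nonempty (Template G E) := by
  have := hG.infinite
  obtain ⟨P, R, hP, hR, hP1, hEP, hER, hhit⟩ := exists_sepBy_hitting hE h1
  have hV : (P⁻¹ * E * P).Finite := (hP.inv.mul hE).mul hP
  have hX : (P⁻¹ * E * R).Finite := (hP.inv.mul hE).mul hR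
  have hVinv : ∀ v ∈ P⁻¹ * E * P, v⁻¹ ∈ P⁻¹ * E * P := by
    rintro _ ⟨_, ⟨p, hp, e, he, rfl⟩, q, hq, rfl⟩
    exact ⟨_, ⟨q⁻¹, by simpa using hq, e⁻¹, hinv e he, rfl⟩, p⁻¹, hp, by simp [mul_assoc]⟩
  obtain ⟨S, hS, hVS, hSX, hpairs⟩ := hG.exists_sepBy_pairs hV hX
    (hX.subset Set.sdiff_subset : ((P⁻¹ * E * R) \ {1}).Finite) hVinv (by simp)
  set W₀ : Set G := E ∪ R⁻¹ * E * R ∪ S⁻¹ * (P⁻¹ * E * P) * S ∪ S⁻¹ * (P⁻¹ * E * R) with hW₀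
  have hW₀fin : W₀.Finite := ((hE.union ((hR.inv.mul hE).mul hR)).union
    ((hS.inv.mul hV).mul hS)).union (hS.inv.mul hX)
  exact ⟨{
    P := P
    R := R
    X := P⁻¹ * E * R
    S₀ := S
    V := P⁻¹ * E * P
    W := W₀ ∪ W₀⁻¹
    finite_P := hP
    finite_R := hR
    finite_X := hX
    finite_S₀ := hS
    finite_V := hV
    finite_W := hW₀fin.union hW₀fin.inv
    one_mem_P := hP1
    one_mem_V := ⟨_, ⟨1, by simpa using hP1, 1, h1, rfl⟩, 1, hP1, by simp⟩
    one_mem_W := Or.inl (Or.inl (Or.inl (Or.inl h1)))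
    inv_mem_V := hVinv
    inv_mem_W := by
      rintro w (h | h)
      · exact Or.inr (by simpa using h)
      · exact Or.inl h
    sepBy_P := hEP
    sepBy_R := hER
    sepBy_S₀ := hVS
    mem_V := fun p hp e he q hq => ⟨_, ⟨p⁻¹, by simpa using hp, e, he, rfl⟩, q, hq, rfl⟩
    hit := hhit
    mem_X := fun p hp e he q hq => ⟨_, ⟨p⁻¹, by simpa using hp, e, he, rfl⟩, q, hq, rfl⟩
    disjoint_S₀_X := hSX
    pairs := fun z hz hz1 => hpairs z ⟨hz, hz1⟩
    subset_W := fun e he => Or.inl (Or.inl (Or.inl (Or.inl he)))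
    mem_W_of_R := fun r hr e he r' hr' => Or.inl (Or.inl (Or.inl (Or.inr
      ⟨_, ⟨r⁻¹, by simpa using hr, e, he, rfl⟩, r', hr', rfl⟩)))
    mem_W_of_S₀ := fun s hs v hv s' hs' => Or.inl (Or.inl (Or.inr
      ⟨_, ⟨s⁻¹, by simpa using hs, v, hv, rfl⟩, s', hs', rfl⟩))
    mem_W_of_X := fun s hs x hx => Or.inl (Or.inr ⟨s⁻¹, by simpa using hs, x, hx, rfl⟩) }⟩

namespace Template

variable {G : Type} [Group G] {E : Set G} (τ : Template G E)

/-- `D` is a set of sites and `S` a set of filling positions as prescribed by the template. -/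
structure Marking (D S : Set G) : Prop where
  sepBy_D : SepBy τ.W D
  net_D : ∀ b, ∃ w ∈ τ.W, w * b ∈ D
  mul_mem_S : ∀ s ∈ τ.S₀, ∀ d ∈ D, s * d ∈ S
  sepBy_S : SepBy τ.V S
  mul_notMem_S : ∀ x ∈ τ.X, ∀ d ∈ D, x * d ∉ S
  net_S : ∀ b, (∃ x ∈ τ.X, x⁻¹ * b ∈ D) ∨ ∃ v ∈ τ.V, v * b ∈ S

/-- The set of markers determined by a pair of sets of sites and filling positions. -/
def markers (D S : Set G) : Set G := τ.R * D ∪ τ.P * S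

variable {τ} {D S D' S' : Set G}

theorem Marking.subset_markers (h : τ.Marking D S) {d : G} (hd : d ∈ D) {r : G}
    (hr : r ∈ τ.R ∪ τ.S₀) : r * d ∈ τ.markers D S := by
  rcases hr with hr | hr
  · exact Or.inl ⟨r, hr, d, hd, rfl⟩
  · exact Or.inr ⟨1, τ.one_mem_P, _, h.mul_mem_S r hr d hd, by simp⟩

theorem Marking.exists_mem_markers (h : τ.Marking D S) (b : G) :
    ∃ r ∈ τ.R ∪ τ.S₀, r * b ∈ τ.markers D S := by
  rcases h.net_S b with ⟨x, hx, hd⟩ | ⟨v, hv, hs⟩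
  · by_cases hx1 : x = 1
    · obtain ⟨p, -, hp⟩ := τ.hit 1 τ.one_mem_V
      exact ⟨_, Or.inl hp, h.subset_markers (by simpa [hx1] using hd) (Or.inl hp)⟩
    · obtain ⟨c, hc, hcx⟩ := τ.pairs x hx hx1
      refine ⟨c, Or.inr hc, ?_⟩
      have := h.subset_markers hd (Or.inr hcx)
      simpa [mul_assoc] using this
  · obtain ⟨p, hp, hpv⟩ := τ.hit v hv
    exact ⟨_, Or.inl hpv, Or.inr ⟨p, hp, _, hs, by simp [mul_assoc]⟩⟩

theorem Marking.exists_mem_markers_inter (h : τ.Marking D S) (h' : τ.Marking D' S') :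
    ∃ k, k ∈ τ.markers D S ∧ k ∈ τ.markers D' S' := by
  obtain ⟨w, -, hw⟩ := h.net_D 1
  obtain ⟨r, hr, hrw⟩ := h'.exists_mem_markers (w * 1)
  exact ⟨_, h.subset_markers hw hr, hrw⟩

theorem Marking.sepBy_markers (h : τ.Marking D S) (hinv : ∀ e ∈ E, e⁻¹ ∈ E) :
    SepBy E (τ.markers D S) := by
  have key : ∀ r ∈ τ.R, ∀ d ∈ D, ∀ p ∈ τ.P, ∀ s ∈ S, r * d * (p * s)⁻¹ ∉ E := by
    intro r hr d hd p hp s hs he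
    refine h.mul_notMem_S _ (τ.mem_X p hp _ (hinv _ he) r hr) d hd ?_
    convert hs using 1
    group
  rintro _ (⟨r, hr, d, hd, rfl⟩ | ⟨p, hp, s, hs, rfl⟩) _
    (⟨r', hr', d', hd', rfl⟩ | ⟨p', hp', s', hs', rfl⟩) he
  · obtain rfl : d = d' := by
      refine h.sepBy_D d hd d' hd' ?_
      convert τ.mem_W_of_R r hr _ he r' hr' using 1
      simp only
      group
    rw [τ.sepBy_R r hr r' hr' (by simpa [mul_assoc] using he)]
  · exact absurd he (key r hr d hd p' hp' s' hs')
  · exact absurd (hinv _ he) (by simpa using key r' hr' d' hd' p hp s hs)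
  · obtain rfl : s = s' := by
      refine h.sepBy_S s hs s' hs' ?_
      convert τ.mem_V p hp _ he p' hp' using 1
      simp only
      group
    rw [τ.sepBy_P p hp p' hp' (by simpa [mul_assoc] using he)]

variable (τ) in
/-- Markings prescribed on sets which are far apart can be realized simultaneously. -/
theorem exists_glue : ∃ Ω : Set G, Ω.Finite ∧ ∀ (I : Type) (A D S : I → Set G),
    (∀ i, τ.Marking (D i) (S i)) →
    (∀ i j, i ≠ j → ∀ a ∈ A i, ∀ b ∈ A j, a * b⁻¹ ∉ Ω) →
    ∃ D' S', τ.Marking D' S' ∧ ∀ i, ∀ a ∈ A i, (a ∈ D' ↔ a ∈ D i) ∧ (a ∈ S' ↔ a ∈ S i) := by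
  set U : Set G := {1} ∪ τ.S₀⁻¹ * τ.V * τ.V ∪ τ.X⁻¹ * τ.V with hU
  have hUfin : U.Finite := ((Set.finite_singleton 1).union
    ((τ.finite_S₀.inv.mul τ.finite_V).mul τ.finite_V)).union (τ.finite_X.inv.mul τ.finite_V)
  set U' : Set G := τ.W * U with hU'
  have hU'fin : U'.Finite := τ.finite_W.mul hUfin
  refine ⟨U'⁻¹ * τ.W * U' ∪ τ.V⁻¹ * τ.V * τ.V, ((hU'fin.inv.mul τ.finite_W).mul hU'fin).union
    ((τ.finite_V.inv.mul τ.finite_V).mul τ.finite_V), fun I A D S hm hA => ?_⟩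
  obtain ⟨D', hDD', -, hsepD', hnetD'⟩ := SepBy.exists_maximal (V := τ.W) (Q := Set.univ)
    (T := {d | ∃ i, d ∈ D i ∧ d ∈ U' * A i}) (by
      rintro _ ⟨i, hi, u, hu, a, ha, rfl⟩ _ ⟨j, hj, v, hv, b, hb, rfl⟩ h
      by_cases hij : i = j
      · subst hij
        exact (hm i).sepBy_D _ hi _ hj h
      · refine absurd (Or.inl ⟨_, ⟨u⁻¹, by simpa using hu, _, h, rfl⟩, v, hv, ?_⟩)
          (hA i j hij a ha b hb)
        simp only
        group) (Set.subset_univ _) τ.one_mem_W τ.inv_mem_W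
  have hD' : ∀ i, ∀ u ∈ U, ∀ a ∈ A i, (u * a ∈ D' ↔ u * a ∈ D i) := by
    intro i u hu a ha
    constructor
    · intro h
      obtain ⟨w, hw, hwd⟩ := (hm i).net_D (u * a)
      have h2 : w * (u * a) ∈ D' := hDD' ⟨i, hwd, w * u, ⟨w, hw, u, hu, rfl⟩, a, ha,
        by simp [mul_assoc]⟩
      rwa [hsepD' _ h2 _ h (by simpa [mul_assoc] using hw)] at hwd
    · exact fun h => hDD' ⟨i, h, u, ⟨1, τ.one_mem_W, u, hu, by simp⟩, a, ha, rfl⟩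
  have hcross : ∀ i, ∀ v ∈ τ.V, ∀ a ∈ A i, v * a ∈ S i → ∀ s ∈ τ.S₀, ∀ d ∈ D',
      s * d * (v * a)⁻¹ ∈ τ.V → s * d = v * a := by
    intro i v hv a ha hva s hs d hd h
    have hd' : d = (s⁻¹ * (s * d * (v * a)⁻¹) * v) * a := by group
    have hdi : d ∈ D i := by
      rw [hd'] at hd ⊢
      exact (hD' i _ (Or.inl (Or.inr ⟨_, ⟨s⁻¹, by simpa using hs, _, h, rfl⟩, v, hv, rfl⟩))
        a ha).1 hd
    exact (hm i).sepBy_S _ ((hm i).mul_mem_S s hs d hdi) _ hva h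
  obtain ⟨S', hSS', hS'Q, hsepS', hnetS'⟩ := SepBy.exists_maximal (V := τ.V)
    (Q := {b | ∀ x ∈ τ.X, x⁻¹ * b ∉ D'})
    (T := {b | ∃ s ∈ τ.S₀, ∃ d ∈ D', b = s * d} ∪ {b | ∃ i, b ∈ S i ∧ b ∈ τ.V * A i}) (by
      rintro _ (⟨s, hs, d, hd, rfl⟩ | ⟨i, hi, v, hv, a, ha, rfl⟩) _
        (⟨s', hs', d', hd', rfl⟩ | ⟨j, hj, v', hv', b, hb, rfl⟩) h
      · obtain rfl : d = d' := by
          refine hsepD' d hd d' hd' ?_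
          convert τ.mem_W_of_S₀ s hs _ h s' hs' using 1
          group
        rw [τ.sepBy_S₀ s hs s' hs' (by simpa [mul_assoc] using h)]
      · exact hcross j v' hv' b hb hj s hs d hd h
      · exact (hcross i v hv a ha hi s' hs' d' hd' (by simpa using τ.inv_mem_V _ h)).symm
      · by_cases hij : i = j
        · subst hij
          exact (hm i).sepBy_S _ hi _ hj h
        · refine absurd (Or.inr ⟨_, ⟨v⁻¹, by simpa using hv, _, h, rfl⟩, v', hv', ?_⟩)
            (hA i j hij a ha b hb)
          simp only
          group) (by
      rintro _ (⟨s, hs, d, hd, rfl⟩ | ⟨i, hi, v, hv, a, ha, rfl⟩) x hx hxd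
      · have : d = x⁻¹ * (s * d) := by
          refine hsepD' d hd _ hxd ?_
          convert τ.mem_W_of_X s hs x hx using 1
          group
        refine Set.disjoint_left.1 τ.disjoint_S₀_X hs ?_
        rw [← mul_assoc, right_eq_mul, inv_mul_eq_one] at this
        rwa [← this]
      · have hxd' : x⁻¹ * (v * a) ∈ D i := by
          rw [← mul_assoc] at hxd ⊢
          exact (hD' i _ (Or.inr ⟨x⁻¹, by simpa using hx, v, hv, rfl⟩) a ha).1 hxd
        exact (hm i).mul_notMem_S x hx _ hxd' (by simpa using hi)) τ.one_mem_V τ.inv_mem_V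
  refine ⟨D', S', ⟨hsepD', fun b => hnetD' b trivial, fun s hs d hd => hSS' (Or.inl ⟨s, hs, d, hd,
    rfl⟩), hsepS', fun x hx d hd h => hS'Q h x hx (by simpa using hd), fun b => ?_⟩,
    fun i a ha => ⟨by simpa using hD' i 1 (Or.inl (Or.inl rfl)) a ha, fun h => ?_, fun h =>
      hSS' (Or.inr ⟨i, h, 1, τ.one_mem_V, a, ha, by simp⟩)⟩⟩
  · by_cases hb : ∀ x ∈ τ.X, x⁻¹ * b ∉ D'
    · exact Or.inr (hnetS' b hb)
    · push Not at hb
      exact Or.inl hb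
  · rcases (hm i).net_S a with ⟨x, hx, hxa⟩ | ⟨v, hv, hva⟩
    · refine absurd ?_ (hS'Q h x hx)
      exact (hD' i _ (Or.inr ⟨x⁻¹, by simpa using hx, 1, τ.one_mem_V, by simp⟩) a ha).2 hxa
    · have h2 : v * a ∈ S' := hSS' (Or.inr ⟨i, hva, v, hv, a, ha, rfl⟩)
      rwa [hsepS' _ h2 _ h (by simpa using hv)] at hva

theorem Marking.translate (h : τ.Marking D S) (g : G) :
    τ.Marking {f | f * g ∈ D} {f | f * g ∈ S} where
  sepBy_D := fun x hx y hy hxy => mul_right_cancel (h.sepBy_D _ hx _ hy (by simpa using hxy))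
  net_D := fun b => by simpa [mul_assoc] using h.net_D (b * g)
  mul_mem_S := fun s hs d hd => by simpa [mul_assoc] using h.mul_mem_S s hs _ hd
  sepBy_S := fun x hx y hy hxy => mul_right_cancel (h.sepBy_S _ hx _ hy (by simpa using hxy))
  mul_notMem_S := fun x hx d hd => by simpa [mul_assoc] using h.mul_notMem_S x hx _ hd
  net_S := fun b => by simpa [mul_assoc] using h.net_S (b * g)

/-- The markings form a closed set: it suffices to approximate on finite sets. -/
theorem Marking.of_forall_finite
    (h : ∀ K : Set G, K.Finite → ∃ D₁ S₁, τ.Marking D₁ S₁ ∧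
      ∀ k ∈ K, (k ∈ D ↔ k ∈ D₁) ∧ (k ∈ S ↔ k ∈ S₁)) : τ.Marking D S where
  sepBy_D := fun x hx y hy hxy => by
    obtain ⟨D₁, S₁, hm, hK⟩ := h {x, y} (Set.toFinite _)
    exact hm.sepBy_D x ((hK x (by simp)).1.1 hx) y ((hK y (by simp)).1.1 hy) hxy
  net_D := fun b => by
    obtain ⟨D₁, S₁, hm, hK⟩ := h ((· * b) '' τ.W) (τ.finite_W.image _)
    obtain ⟨w, hw, hwb⟩ := hm.net_D b
    exact ⟨w, hw, (hK _ ⟨w, hw, rfl⟩).1.2 hwb⟩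
  mul_mem_S := fun s hs d hd => by
    obtain ⟨D₁, S₁, hm, hK⟩ := h {d, s * d} (Set.toFinite _)
    exact (hK _ (by simp)).2.2 (hm.mul_mem_S s hs d ((hK d (by simp)).1.1 hd))
  sepBy_S := fun x hx y hy hxy => by
    obtain ⟨D₁, S₁, hm, hK⟩ := h {x, y} (Set.toFinite _)
    exact hm.sepBy_S x ((hK x (by simp)).2.1 hx) y ((hK y (by simp)).2.1 hy) hxy
  mul_notMem_S := fun x hx d hd hxd => by
    obtain ⟨D₁, S₁, hm, hK⟩ := h {d, x * d} (Set.toFinite _)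
    exact hm.mul_notMem_S x hx d ((hK d (by simp)).1.1 hd) ((hK _ (by simp)).2.1 hxd)
  net_S := fun b => by
    obtain ⟨D₁, S₁, hm, hK⟩ := h ((fun x => x⁻¹ * b) '' τ.X ∪ (· * b) '' τ.V)
      ((τ.finite_X.image _).union (τ.finite_V.image _))
    rcases hm.net_S b with ⟨x, hx, hd⟩ | ⟨v, hv, hs⟩
    · exact Or.inl ⟨x, hx, (hK _ (Or.inl ⟨x, hx, rfl⟩)).1.2 hd⟩
    · exact Or.inr ⟨v, hv, (hK _ (Or.inr ⟨v, hv, rfl⟩)).2.2 hs⟩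

end Template

/-- Configurations: sequences of pairs of subsets of `G`, encoded by Boolean functions. -/
abbrev Conf (G : Type) := G → ℕ → Bool × Bool

namespace Conf

variable {G : Type}

/-- The `n`-th set of sites of a configuration. -/
def sites (x : Conf G) (n : ℕ) : Set G := {g | (x g n).1 = true}

/-- The `n`-th set of filling positions of a configuration. -/
def fills (x : Conf G) (n : ℕ) : Set G := {g | (x g n).2 = true}

theorem exists_mem_agree_of_mem_closure {C : Set (Conf G)} {x : Conf G} (hx : x ∈ closure C)
    {K : Set G} (hK : K.Finite) (n : ℕ) : ∃ y ∈ C, ∀ k ∈ K, ∀ j ≤ n, y k j = x k j := by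
  have hopen : IsOpen (⋂ k ∈ K, ⋂ j ∈ Set.Iic n, {y : Conf G | y k j = x k j}) := by
    refine hK.isOpen_biInter fun k _ => (Set.finite_Iic n).isOpen_biInter fun j _ => ?_
    exact (isOpen_discrete {x k j}).preimage
      ((continuous_apply j).comp (continuous_apply k) : Continuous fun y : Conf G => y k j)
  obtain ⟨y, hy, hyC⟩ := mem_closure_iff.1 hx _ hopen (by simp)
  refine ⟨y, hyC, fun k hk j hj => ?_⟩
  simp only [Set.mem_iInter] at hy
  exact hy k hk j hj

variable [Group G]

/-- The left action of `G` on configurations by right translation of the argument. -/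
def shift (h : G) (x : Conf G) : Conf G := fun g => x (g * h)

theorem continuous_shift (h : G) : Continuous (shift h : Conf G → Conf G) :=
  continuous_pi fun g => continuous_apply (g * h)

/-- Closed invariant sets of configurations which are determined by the coordinates below `n`,
and in which patterns prescribed on sets that are far apart can be realized simultaneously. -/
structure IsLevel (n : ℕ) (X : Set (Conf G)) : Prop where
  isClosed : IsClosed X
  shift_mem : ∀ x ∈ X, ∀ h, shift h x ∈ X
  mem_of_agree : ∀ x ∈ X, ∀ y : Conf G, (∀ g, ∀ j < n, y g j = x g j) → y ∈ X
  exists_glue : ∃ Ω : Set G, Ω.Finite ∧ ∀ (I : Type) (A : I → Set G) (x : I → Conf G),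
    (∀ i, x i ∈ X) → (∀ i j, i ≠ j → ∀ a ∈ A i, ∀ b ∈ A j, a * b⁻¹ ∉ Ω) →
    ∃ z ∈ X, ∀ i, ∀ a ∈ A i, ∀ k < n, z a k = x i a k

theorem IsLevel.univ : IsLevel 0 (Set.univ : Set (Conf G)) where
  isClosed := isClosed_univ
  shift_mem := fun _ _ _ => trivial
  mem_of_agree := fun _ _ _ _ => trivial
  exists_glue := ⟨∅, Set.finite_empty, fun _ _ _ _ _ =>
    ⟨fun _ _ => (true, true), trivial, fun _ _ _ _ h => absurd h (Nat.not_lt_zero _)⟩⟩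

theorem IsLevel.nonempty {n : ℕ} {X : Set (Conf G)} (hX : IsLevel n X) : X.Nonempty := by
  obtain ⟨Ω, -, h⟩ := hX.exists_glue
  obtain ⟨z, hz, -⟩ := h Empty (fun _ => ∅) (fun i => i.elim) (fun i => i.elim) (fun i => i.elim)
  exact ⟨z, hz⟩

/-- The configurations in `X` whose `n`-th coordinates form a marking for `τ`, and which show the
pattern of `x₀` on `F` below `n` at each marker. -/
def refinement {E : Set G} (τ : Template G E) (n : ℕ) (X : Set (Conf G)) (F : Set G)
    (x₀ : Conf G) : Set (Conf G) :=
  {x | x ∈ X ∧ τ.Marking (x.sites n) (x.fills n) ∧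
    ∀ t ∈ τ.markers (x.sites n) (x.fills n), ∀ f ∈ F, ∀ j < n, x (f * t) j = x₀ f j}

theorem isClosed_refinement {E : Set G} (τ : Template G E) (n : ℕ) {X : Set (Conf G)}
    (hX : IsClosed X) (F : Set G) (x₀ : Conf G) : IsClosed (refinement τ n X F x₀) := by
  refine isClosed_of_closure_subset fun x hx => ⟨?_, ?_, ?_⟩
  · exact hX.closure_subset_iff.2 (fun y hy => hy.1) hx
  · refine Template.Marking.of_forall_finite fun K hK => ?_
    obtain ⟨y, hy, hyx⟩ := exists_mem_agree_of_mem_closure hx hK n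
    exact ⟨_, _, hy.2.1, fun k hk => by simp [sites, fills, hyx k hk n le_rfl]⟩
  · rintro _ (⟨r, hr, d, hd, rfl⟩ | ⟨p, hp, s, hs, rfl⟩) f hf j hj
    · obtain ⟨y, hy, hyx⟩ := exists_mem_agree_of_mem_closure hx
        (Set.toFinite {d, f * (r * d)}) n
      have hd' : d ∈ y.sites n := by simpa [sites, hyx d (by simp) n le_rfl] using hd
      simp only
      rw [← hyx (f * (r * d)) (by simp) j hj.le]
      exact hy.2.2 _ (Or.inl ⟨r, hr, d, hd', rfl⟩) f hf j hj
    · obtain ⟨y, hy, hyx⟩ := exists_mem_agree_of_mem_closure hx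
        (Set.toFinite {s, f * (p * s)}) n
      have hs' : s ∈ y.fills n := by simpa [fills, hyx s (by simp) n le_rfl] using hs
      simp only
      rw [← hyx (f * (p * s)) (by simp) j hj.le]
      exact hy.2.2 _ (Or.inr ⟨p, hp, s, hs', rfl⟩) f hf j hj

theorem isLevel_refinement {E : Set G} (τ : Template G E) {n : ℕ} {X : Set (Conf G)}
    (hX : IsLevel n X) {F : Set G} (hF : F.Finite) {x₀ : Conf G} (hx₀ : x₀ ∈ X) {Ω : Set G}
    (hΩ : Ω.Finite) (hΩinv : ∀ ω ∈ Ω, ω⁻¹ ∈ Ω)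
    (hglue : ∀ (I : Type) (A : I → Set G) (x : I → Conf G), (∀ i, x i ∈ X) →
      (∀ i j, i ≠ j → ∀ a ∈ A i, ∀ b ∈ A j, a * b⁻¹ ∉ Ω) →
      ∃ z ∈ X, ∀ i, ∀ a ∈ A i, ∀ k < n, z a k = x i a k)
    (hEinv : ∀ e ∈ E, e⁻¹ ∈ E) (hE : ∀ f ∈ F, ∀ ω ∈ Ω, ∀ f' ∈ F, f⁻¹ * ω * f' ∈ E) :
    IsLevel (n + 1) (refinement τ n X F x₀) where
  isClosed := isClosed_refinement τ n hX.isClosed F x₀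
  shift_mem := by
    rintro x ⟨hx, hm, ht⟩ h
    refine ⟨hX.shift_mem x hx h, hm.translate h, ?_⟩
    have key : ∀ t, t ∈ τ.markers ((shift h x).sites n) ((shift h x).fills n) →
        t * h ∈ τ.markers (x.sites n) (x.fills n) := by
      rintro _ (⟨r, hr, d, hd, rfl⟩ | ⟨p, hp, s, hs, rfl⟩)
      · exact Or.inl ⟨r, hr, d * h, hd, by simp [mul_assoc]⟩
      · exact Or.inr ⟨p, hp, s * h, hs, by simp [mul_assoc]⟩
    intro t ht' f hf j hj
    simpa [shift, mul_assoc] using ht _ (key t ht') f hf j hj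
  mem_of_agree := by
    rintro x ⟨hx, hm, ht⟩ y hy
    have h1 : y.sites n = x.sites n := by ext g; simp [sites, hy g n (Nat.lt_succ_self n)]
    have h2 : y.fills n = x.fills n := by ext g; simp [fills, hy g n (Nat.lt_succ_self n)]
    refine ⟨hX.mem_of_agree x hx y fun g j hj => hy g j (Nat.lt_succ_of_lt hj), ?_, ?_⟩
    · rwa [h1, h2]
    · rw [h1, h2]
      intro t ht' f hf j hj
      rw [hy _ j (Nat.lt_succ_of_lt hj)]
      exact ht t ht' f hf j hj
  exists_glue := by
    classical
    obtain ⟨Ωτ, hΩτ, hglueτ⟩ := τ.exists_glue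
    set U : Set G := {1} ∪ τ.R⁻¹ * (F⁻¹ * Ω) ∪ τ.P⁻¹ * (F⁻¹ * Ω) with hU
    have hUfin : U.Finite := ((Set.finite_singleton 1).union
      (τ.finite_R.inv.mul (hF.inv.mul hΩ))).union (τ.finite_P.inv.mul (hF.inv.mul hΩ))
    set U' : Set G := {1} ∪ F * (F⁻¹ * Ω) with hU'
    have hU'fin : U'.Finite := (Set.finite_singleton 1).union (hF.mul (hF.inv.mul hΩ))
    refine ⟨U⁻¹ * Ωτ * U ∪ U'⁻¹ * Ω * U', ((hUfin.inv.mul hΩτ).mul hUfin).union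
      ((hU'fin.inv.mul hΩ).mul hU'fin), fun I A x hx hA => ?_⟩
    obtain ⟨D, S, hm, hDS⟩ := hglueτ I (fun i => U * A i) (fun i => (x i).sites n)
      (fun i => (x i).fills n) (fun i => (hx i).2.1) (by
        rintro i j hij _ ⟨u, hu, a, ha, rfl⟩ _ ⟨v, hv, b, hb, rfl⟩ h
        refine hA i j hij a ha b hb (Or.inl ⟨_, ⟨u⁻¹, by simpa using hu, _, h, rfl⟩, v, hv, ?_⟩)
        simp only
        group)
    have hagree : ∀ i, ∀ u ∈ U, ∀ a ∈ A i, (u * a ∈ D ↔ u * a ∈ (x i).sites n) ∧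
        (u * a ∈ S ↔ u * a ∈ (x i).fills n) := fun i u hu a ha => hDS i _ ⟨u, hu, a, ha, rfl⟩
    set T : Set G := τ.markers D S with hT
    have hsep : SepBy E T := hm.sepBy_markers hEinv
    have hTF : ∀ t ∈ T, ∀ t' ∈ T, ∀ f ∈ F, ∀ f' ∈ F, f * t * (f' * t')⁻¹ ∈ Ω → t = t' := by
      intro t ht t' ht' f hf f' hf' h
      refine hsep t ht t' ht' ?_
      convert hE f hf _ h f' hf' using 1
      group
    let near : I → G → Prop := fun i t => ∃ f ∈ F, ∃ a ∈ A i, f * t * a⁻¹ ∈ Ω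
    have hnear : ∀ i, ∀ t ∈ T, near i t → t ∈ τ.markers ((x i).sites n) ((x i).fills n) := by
      rintro i _ (⟨r, hr, d, hd, rfl⟩ | ⟨p, hp, s, hs, rfl⟩) ⟨f, hf, a, ha, h⟩
      · refine Or.inl ⟨r, hr, d, ?_, rfl⟩
        have hda : d = r⁻¹ * (f⁻¹ * (f * (r * d) * a⁻¹)) * a := by group
        rw [hda] at hd ⊢
        exact (hagree i _ (Or.inl (Or.inr ⟨r⁻¹, by simpa using hr, _,
          ⟨f⁻¹, by simpa using hf, _, h, rfl⟩, rfl⟩)) a ha).1.1 hd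
      · refine Or.inr ⟨p, hp, s, ?_, rfl⟩
        have hsa : s = p⁻¹ * (f⁻¹ * (f * (p * s) * a⁻¹)) * a := by group
        rw [hsa] at hs ⊢
        exact (hagree i _ (Or.inr ⟨p⁻¹, by simpa using hp, _,
          ⟨f⁻¹, by simpa using hf, _, h, rfl⟩, rfl⟩) a ha).2.1 hs
    let B : I → Set G := fun i => A i ∪ {g | ∃ t ∈ T, near i t ∧ ∃ f ∈ F, g = f * t}
    have hB : ∀ i, ∀ g ∈ B i, ∃ u ∈ U', ∃ a ∈ A i, g = u * a := by
      rintro i g (hg | ⟨t, -, ⟨f, hf, a, ha, h⟩, f', hf', rfl⟩)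
      · exact ⟨1, Or.inl rfl, g, hg, by simp⟩
      · exact ⟨_, Or.inr ⟨f', hf', _, ⟨f⁻¹, by simpa using hf, _, h, rfl⟩, rfl⟩, a, ha,
          by simp [mul_assoc]⟩
    let J := {t // t ∈ T ∧ ∀ i, ¬ near i t}
    have hBJ : ∀ i (t : J), ∀ g ∈ B i, ∀ f ∈ F, g * (f * (t : G))⁻¹ ∉ Ω := by
      rintro i ⟨t, ht, hfar⟩ g (hg | ⟨t', ht', hn, f', hf', rfl⟩) f hf h
      · exact hfar i ⟨f, hf, g, hg, by simpa [mul_assoc] using hΩinv _ h⟩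
      · obtain rfl := hTF t' ht' t ht f' hf' f hf h
        exact hfar i hn
    obtain ⟨z, hz, hzA⟩ := hglue (I ⊕ J)
      (Sum.elim B fun t => {g | ∃ f ∈ F, g = f * (t : G)})
      (Sum.elim x fun t => shift (t : G)⁻¹ x₀) (by
        rintro (i | t)
        · exact (hx i).1
        · exact hX.shift_mem x₀ hx₀ _) (by
        rintro (i | t) (j | t') hij a ha b hb h
        · obtain ⟨u, hu, a', ha', rfl⟩ := hB i a ha
          obtain ⟨v, hv, b', hb', rfl⟩ := hB j b hb
          refine hA i j (fun h => hij (by rw [h])) a' ha' b' hb'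
            (Or.inr ⟨_, ⟨u⁻¹, by simpa using hu, _, h, rfl⟩, v, hv, ?_⟩)
          simp only
          group
        · obtain ⟨f, hf, rfl⟩ := hb
          exact hBJ i t' a ha f hf h
        · obtain ⟨f, hf, rfl⟩ := ha
          exact hBJ j t b hb f hf (by simpa [mul_assoc] using hΩinv _ h)
        · obtain ⟨f, hf, rfl⟩ := ha
          obtain ⟨f', hf', rfl⟩ := hb
          exact hij (congrArg Sum.inr (Subtype.ext (hTF t t.2.1 t' t'.2.1 f hf f' hf' h))))
    let z' : Conf G := fun g j => if j = n then (decide (g ∈ D), decide (g ∈ S)) else z g j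
    have hz'n : ∀ g, ∀ j < n, z' g j = z g j := fun g j hj => if_neg hj.ne
    have hz's : z'.sites n = D := by ext g; simp [sites, z']
    have hz'f : z'.fills n = S := by ext g; simp [fills, z']
    refine ⟨z', ⟨hX.mem_of_agree z hz z' hz'n, by rwa [hz's, hz'f], ?_⟩, ?_⟩
    · rw [hz's, hz'f]
      intro t ht f hf j hj
      rw [hz'n _ j hj]
      by_cases hfar : ∃ i, near i t
      · obtain ⟨i, hi⟩ := hfar
        rw [hzA (Sum.inl i) (f * t) (Or.inr ⟨t, ht, hi, f, hf, rfl⟩) j hj]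
        exact (hx i).2.2 t (hnear i t ht hi) f hf j hj
      · push Not at hfar
        rw [hzA (Sum.inr ⟨t, ht, hfar⟩) (f * t) ⟨f, hf, rfl⟩ j hj]
        simp [shift]
    · intro i a ha k hk
      rcases Nat.lt_succ_iff_lt_or_eq.1 hk with hk | rfl
      · rw [hz'n _ k hk]
        exact hzA (Sum.inl i) a (Or.inl ha) k hk
      · have h1 := hagree i 1 (Or.inl (Or.inl rfl)) a ha
        rw [one_mul] at h1
        simp [z', h1.1, h1.2, sites, fills]

theorem IsLevel.exists_refinement (hG : IsICC G) {n : ℕ} {X : Set (Conf G)} (hX : IsLevel n X)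
    {F : Set G} (hF : F.Finite) : ∃ X' ⊆ X, IsLevel (n + 1) X' ∧
      (∀ x ∈ X', ∀ y ∈ X', ∃ k, ∀ f ∈ F, ∀ j < n, x (f * k) j = y (f * k) j) ∧
      ∀ x ∈ X', ∀ g ∈ F, g ≠ 1 → ∃ d, x (g * d) n ≠ x d n := by
  obtain ⟨x₀, hx₀⟩ := hX.nonempty
  obtain ⟨Ω, hΩ, hglue⟩ := hX.exists_glue
  have hΩ' : (Ω ∪ Ω⁻¹).Finite := hΩ.union hΩ.inv
  have hΩinv : ∀ ω ∈ Ω ∪ Ω⁻¹, ω⁻¹ ∈ Ω ∪ Ω⁻¹ := by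
    rintro ω (h | h)
    · exact Or.inr (by simpa using h)
    · exact Or.inl h
  set E₀ : Set G := {1} ∪ F ∪ F⁻¹ * (Ω ∪ Ω⁻¹) * F with hE₀
  have hE₀fin : E₀.Finite := ((Set.finite_singleton 1).union hF).union ((hF.inv.mul hΩ').mul hF)
  have hEinv : ∀ e ∈ E₀ ∪ E₀⁻¹, e⁻¹ ∈ E₀ ∪ E₀⁻¹ := by
    rintro e (h | h)
    · exact Or.inr (by simpa using h)
    · exact Or.inl h
  obtain ⟨τ⟩ := hG.nonempty_template (hE₀fin.union hE₀fin.inv) (Or.inl (Or.inl (Or.inl rfl)))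
    hEinv
  refine ⟨refinement τ n X F x₀, fun x hx => hx.1, isLevel_refinement τ hX hF hx₀ hΩ' hΩinv
    (fun I A x hx hA => hglue I A x hx fun i j hij a ha b hb h =>
      hA i j hij a ha b hb (Or.inl h)) hEinv (fun f hf ω hω f' hf' =>
      Or.inl (Or.inr ⟨_, ⟨f⁻¹, by simpa using hf, ω, hω, rfl⟩, f', hf', rfl⟩)), ?_, ?_⟩
  · intro x hx y hy
    obtain ⟨k, hkx, hky⟩ := hx.2.1.exists_mem_markers_inter hy.2.1
    exact ⟨k, fun f hf j hj => (hx.2.2 k hkx f hf j hj).trans (hy.2.2 k hky f hf j hj).symm⟩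
  · intro x hx g hg hg1
    obtain ⟨d, -, hd⟩ := hx.2.1.net_D 1
    refine ⟨d * 1, fun h => hg1 ?_⟩
    have hgd : g * (d * 1) ∈ x.sites n := by simpa only [sites, Set.mem_ofPred_eq, h] using hd
    have := hx.2.1.sepBy_D _ hgd _ hd
      (by simpa [mul_assoc] using τ.subset_W (Or.inl (Or.inl (Or.inr hg))))
    simpa using this

/-- For an ICC group there is a nonempty closed invariant set of configurations in which every two
points are proximal, and on every point of which no nontrivial element of `G` acts trivially along
the whole orbit. -/
theorem exists_proximal [Countable G] (hG : IsICC G) : ∃ Z : Set (Conf G), Z.Nonempty ∧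
    IsClosed Z ∧ (∀ x ∈ Z, ∀ h, shift h x ∈ Z) ∧
    (∀ x ∈ Z, ∀ y ∈ Z, ∃ k : ℕ → G, ∀ g j, ∀ᶠ n in Filter.atTop,
      shift (k n) x g j = shift (k n) y g j) ∧
    ∀ x ∈ Z, ∀ g, g ≠ 1 → ∃ d n, x (g * d) n ≠ x d n := by
  obtain ⟨c, hc⟩ := exists_injective_nat G
  let F : ℕ → Set G := fun n => c ⁻¹' Set.Iio n
  have hF : ∀ n, (F n).Finite := fun n => (Set.finite_Iio n).preimage hc.injOn
  choose next hsub hlevel hprox hfree using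
    fun (n : ℕ) (X : {X : Set (Conf G) // IsLevel n X}) => X.2.exists_refinement hG (hF n)
  let X : ∀ n, {X : Set (Conf G) // IsLevel n X} := fun n =>
    Nat.rec ⟨Set.univ, IsLevel.univ⟩ (fun n X => ⟨next n X, hlevel n X⟩) n
  have hX : ∀ n, (X (n + 1)).1 = next n (X n) := fun n => rfl
  have hmem : ∀ {x}, x ∈ ⋂ n, (X n).1 → ∀ n, x ∈ (X n).1 := fun hx => Set.mem_iInter.1 hx
  refine ⟨⋂ n, (X n).1, ?_, isClosed_iInter fun n => (X n).2.isClosed, ?_, ?_, ?_⟩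
  · exact IsCompact.nonempty_iInter_of_sequence_nonempty_isCompact_isClosed _
      (fun n => hsub n (X n)) (fun n => (X n).2.nonempty) (X 0).2.isClosed.isCompact
      fun n => (X n).2.isClosed
  · exact fun x hx h => Set.mem_iInter.2 fun n => (X n).2.shift_mem x (hmem hx n) h
  · intro x hx y hy
    choose k hk using fun n => hprox n (X n) x (hmem hx (n + 1)) y (hmem hy (n + 1))
    refine ⟨k, fun g j => ?_⟩
    filter_upwards [Filter.eventually_gt_atTop (c g), Filter.eventually_gt_atTop j] with n h1 h2
    exact hk n g h1 j h2
  · intro x hx g hg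
    obtain ⟨d, hd⟩ := hfree (c g + 1) (X (c g + 1)) x (hmem hx (c g + 1 + 1)) g
      (Nat.lt_succ_self _) hg
    exact ⟨d, _, hd⟩

/-- A nonempty closed invariant set of configurations contains a minimal one. -/
theorem exists_minimal {Z : Set (Conf G)} (hZ : Z.Nonempty) (hZc : IsClosed Z)
    (hZi : ∀ x ∈ Z, ∀ h, shift h x ∈ Z) : ∃ M ⊆ Z, M.Nonempty ∧ IsClosed M ∧
      (∀ x ∈ M, ∀ h, shift h x ∈ M) ∧
      ∀ x ∈ M, M ⊆ closure (Set.range fun h => shift h x) := by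
  obtain ⟨M, hMZ, hM⟩ := zorn_superset_nonempty
    {M : Set (Conf G) | M.Nonempty ∧ IsClosed M ∧ ∀ x ∈ M, ∀ h, shift h x ∈ M} (by
      intro C hC hchain hne
      have : Nonempty C := hne.to_subtype
      refine ⟨⋂₀ C, ⟨?_, isClosed_sInter fun s hs => (hC hs).2.1, fun x hx h s hs =>
        (hC hs).2.2 x (hx s hs) h⟩, fun s hs => Set.sInter_subset_of_mem hs⟩
      exact IsCompact.nonempty_sInter_of_directed_nonempty_isCompact_isClosed
        (fun s hs t ht => (hchain.total hs ht).elim (fun h => ⟨s, hs, subset_rfl, h⟩)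
          fun h => ⟨t, ht, h, subset_rfl⟩) (fun s hs => (hC hs).1)
        (fun s hs => (hC hs).2.1.isCompact) fun s hs => (hC hs).2.1) Z ⟨hZ, hZc, hZi⟩
  refine ⟨M, hMZ, hM.prop.1, hM.prop.2.1, hM.prop.2.2, fun x hx => ?_⟩
  refine hM.le_of_le (y := closure (Set.range fun h => shift h x))
    ⟨⟨_, subset_closure ⟨1, rfl⟩⟩, isClosed_closure, fun y hy h => ?_⟩
    (hM.prop.2.1.closure_subset_iff.2 ?_)
  · refine map_mem_closure (continuous_shift h) hy ?_
    rintro _ ⟨k, rfl⟩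
    exact ⟨h * k, by funext g; simp [shift, mul_assoc]⟩
  · rintro _ ⟨h, rfl⟩
    exact hM.prop.2.2 x hx h

end Conf

/-- Every countable ICC group admits a continuous action on a nonempty compact metrizable
space that is faithful, minimal, and proximal. -/
theorem icc_admits_faithful_minimal_proximal_action
    (G : Type) [Group G] [Countable G] (hICC : IsICC G) :
    ∃ (X : Type) (_ : TopologicalSpace X) (_ : MulAction G X),
      CompactSpace X ∧ TopologicalSpace.MetrizableSpace X ∧ Nonempty X ∧
      ContinuousConstSMul G X ∧
      (∀ g : G, (∀ x : X, g • x = x) → g = 1) ∧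
      (∀ x : X, Dense (Set.range fun g : G => g • x)) ∧
      IsProximalAction G X := by
  obtain ⟨Z, hZ, hZc, hZi, hprox, hfree⟩ := Conf.exists_proximal hICC
  obtain ⟨M, hMZ, ⟨x₀, hx₀⟩, hMc, hMi, hmin⟩ := Conf.exists_minimal hZ hZc hZi
  let act : MulAction G M :=
    { smul := fun g x => ⟨Conf.shift g x.1, hMi x.1 x.2 g⟩
      one_smul := fun x => Subtype.ext (by funext g; exact congrArg x.1 (mul_one g))
      mul_smul := fun a b x => Subtype.ext (by funext g; exact congrArg x.1 (mul_assoc g a b).symm) }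
  have hsmul : ∀ (g : G) (x : M), (g • x).1 = Conf.shift g x.1 := fun g x => rfl
  have hcompact : CompactSpace M := isCompact_iff_compactSpace.1 hMc.isCompact
  refine ⟨M, inferInstance, act, hcompact, inferInstance, ⟨⟨x₀, hx₀⟩⟩, ⟨fun g => ?_⟩, fun g hg => ?_,
    fun x => ?_, fun x y => ?_⟩
  · exact ((Conf.continuous_shift g).comp continuous_subtype_val).subtype_mk _
  · by_contra hg1
    obtain ⟨d, n, hd⟩ := hfree x₀ (hMZ hx₀) g hg1
    have := congrArg Subtype.val (hg ⟨Conf.shift d x₀, hMi x₀ hx₀ d⟩)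
    rw [hsmul] at this
    exact hd (by simpa [Conf.shift] using congrFun (congrFun this 1) n)
  · refine Subtype.dense_iff.2 fun y hy => ?_
    rw [← Set.range_comp]
    exact hmin x.1 x.2 hy
  · obtain ⟨k, hk⟩ := hprox x.1 (hMZ x.2) y.1 (hMZ y.2)
    obtain ⟨⟨a, b⟩, hab⟩ := exists_clusterPt_of_compactSpace
      (Filter.map (fun n => (k n • x, k n • y)) Filter.atTop)
    obtain rfl : a = b := by
      refine Subtype.ext (funext fun g => funext fun j => ?_)
      have hcl : IsClosed {p : M × M | p.1.1 g j = p.2.1 g j} := by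
        refine isClosed_eq ?_ ?_
        · exact (continuous_apply j).comp ((continuous_apply g).comp
            (continuous_subtype_val.comp continuous_fst))
        · exact (continuous_apply j).comp ((continuous_apply g).comp
            (continuous_subtype_val.comp continuous_snd))
      refine isClosed_iff_clusterPt.1 hcl _ (hab.mono (Filter.le_principal_iff.2 ?_))
      exact Filter.mem_map.2 (hk g j)
    refine ⟨a, mem_closure_iff_clusterPt.2 (hab.mono (Filter.le_principal_iff.2 ?_))⟩
    exact Filter.mem_map.2 (Filter.univ_mem' fun n => ⟨k n, rfl⟩)
end

section
/- Let G be a countable group with the property that for every finite symmetric X ⊆ G containing the identity there exist a configuration s ∈ 2^G and a finite symmetric Y ⊇ X such that (1) s(a) = s(b) = 1 implies a and b are X-apart, and (2) for every g, h ∈ Y^100 there exists a ∈ Y with s(g·a) = s(h·a) = 1. Then for every finite symmetric X ⊆ G containing the identity there exists a strongly irreducible X-witness shift S ⊆ 2^G. -/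
open scoped Pointwise

/-- The left-translation action of `G` on configurations: `(g • s)(h) = s (g⁻¹ * h)`. -/
def shiftAct {G A : Type*} [Group G] (g : G) (s : G → A) : G → A :=
  fun h => s (g⁻¹ * h)

/-- A shift: a nonempty, closed, `G`-invariant subset of the full shift `A^G` (with the
product topology and the left-translation action). -/
def IsShift {G A : Type*} [Group G] [TopologicalSpace A] (S : Set (G → A)) : Prop :=
  S.Nonempty ∧ IsClosed S ∧ ∀ s ∈ S, ∀ g : G, shiftAct g s ∈ S

/-- A shift `S ⊆ A^G` is strongly irreducible if there is a finite `X ⊆ G` containing the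
identity such that for all `E₁, E₂ ⊆ G` with `E₁X ∩ E₂X = ∅` and all `s₁, s₂ ∈ S` there is
`s ∈ S` agreeing with `s₁` on `E₁` and with `s₂` on `E₂`. -/
def StronglyIrreducible {G A : Type*} [Group G] (S : Set (G → A)) : Prop :=
  ∃ X : Finset G, (1 : G) ∈ X ∧
    ∀ E₁ E₂ : Set G, (E₁ * (X : Set G)) ∩ (E₂ * (X : Set G)) = ∅ →
      ∀ s₁ ∈ S, ∀ s₂ ∈ S, ∃ s ∈ S, (∀ a ∈ E₁, s a = s₁ a) ∧ (∀ a ∈ E₂, s a = s₂ a)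

/-- For a finite symmetric `X ⊆ G`, elements `a, b ∈ G` are `X`-apart if `a⁻¹ * b ∉ X`. -/
def XApart {G : Type*} [Group G] (X : Finset G) (a b : G) : Prop :=
  a⁻¹ * b ∉ X

/-- A shift `S ⊆ 2^G` is an `X`-witness shift if (1) for every `s ∈ S`, distinct `a, b` with
`s a = s b = 1` are `X`-apart, and (2) for all `s, t ∈ S` there is `a ∈ G` with
`s a = t a = 1`. -/
def IsWitnessShift {G : Type*} [Group G] (X : Finset G) (S : Set (G → Fin 2)) : Prop :=
  (∀ s ∈ S, ∀ a b : G, s a = 1 → s b = 1 → a ≠ b → XApart X a b) ∧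
  (∀ s ∈ S, ∀ t ∈ S, ∃ a : G, s a = 1 ∧ t a = 1)

/-- A set `A` of allowed points contains a maximal `r`-independent set extending a given one. -/
theorem exists_maximal_independent {α : Type*} (r : α → α → Prop) (hrefl : ∀ x, r x x)
    (hsymm : ∀ x y, r x y → r y x) (A L₀ : Set α) (hA : L₀ ⊆ A)
    (hL₀ : ∀ x ∈ L₀, ∀ y ∈ L₀, r x y → x = y) :
    ∃ L, L₀ ⊆ L ∧ L ⊆ A ∧ (∀ x ∈ L, ∀ y ∈ L, r x y → x = y) ∧ ∀ x ∈ A, ∃ y ∈ L, r x y := by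
  obtain ⟨L, hL₀L, hL⟩ := zorn_subset_nonempty
    {L : Set α | L ⊆ A ∧ ∀ x ∈ L, ∀ y ∈ L, r x y → x = y} (fun c hc hchain _ => by
      refine ⟨⋃₀ c, ⟨Set.sUnion_subset fun s hs => (hc hs).1, ?_⟩,
        fun s hs => Set.subset_sUnion_of_mem hs⟩
      rintro x ⟨s, hs, hxs⟩ y ⟨t, ht, hyt⟩ hxy
      rcases hchain.total hs ht with h | h
      · exact (hc ht).2 x (h hxs) y hyt hxy
      · exact (hc hs).2 x hxs y (h hyt) hxy) L₀ ⟨hA, hL₀⟩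
  refine ⟨L, hL₀L, hL.prop.1, hL.prop.2, fun x hx => ?_⟩
  by_contra! hno
  have hins : insert x L ∈ {L : Set α | L ⊆ A ∧ ∀ x ∈ L, ∀ y ∈ L, r x y → x = y} := by
    refine ⟨Set.insert_subset hx hL.prop.1, ?_⟩
    rintro a (rfl | ha) b (rfl | hb) hab
    · rfl
    · exact absurd hab (hno b hb)
    · exact absurd (hsymm _ _ hab) (hno a ha)
    · exact hL.prop.2 a ha b hb hab
  exact hno x (hL.le_of_ge hins (Set.subset_insert x L) (Set.mem_insert x L)) (hrefl x)

section Cells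

variable {G : Type} [Group G] [DecidableEq G]

/-- `h` lies in the left translate `g * Y ^ n`. -/
def Near (Y : Finset G) (n : ℕ) (g h : G) : Prop :=
  g⁻¹ * h ∈ Y ^ n

theorem Near.trans {Y : Finset G} {m n : ℕ} {a b c : G} (hab : Near Y m a b)
    (hbc : Near Y n b c) : Near Y (m + n) a c := by
  have := Finset.mul_mem_mul hab hbc
  rw [← pow_add] at this
  simpa [Near, mul_assoc] using this

theorem Near.mono {Y : Finset G} (h1 : (1 : G) ∈ Y) {m n : ℕ} {a b : G} (hab : Near Y m a b)
    (hmn : m ≤ n) : Near Y n a b :=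
  Finset.pow_subset_pow_right h1 hmn hab

theorem Near.symm {Y : Finset G} (hY : ∀ y ∈ Y, y⁻¹ ∈ Y) {n : ℕ} {a b : G}
    (hab : Near Y n a b) : Near Y n b a := by
  have hinv : Y⁻¹ = Y := by
    ext y
    rw [Finset.mem_inv']
    exact ⟨fun h => by simpa using hY _ h, hY y⟩
  have : (a⁻¹ * b)⁻¹ ∈ Y ^ n := by
    rw [← Finset.mem_inv', ← inv_pow, hinv]
    exact hab
  simpa [Near] using this

theorem Near.refl {Y : Finset G} (h1 : (1 : G) ∈ Y) (n : ℕ) (a : G) : Near Y n a a := by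
  simpa [Near] using Finset.one_mem_pow h1

theorem Near.exists_between {Y : Finset G} {m n : ℕ} {a c : G} (h : Near Y (m + n) a c) :
    ∃ b, Near Y m a b ∧ Near Y n b c := by
  unfold Near at h
  rw [pow_add, Finset.mem_mul] at h
  obtain ⟨u, hu, v, hv, huv⟩ := h
  refine ⟨a * u, by simpa [Near] using hu, ?_⟩
  have : (a * u)⁻¹ * c = v := by
    rw [mul_inv_rev, mul_assoc, ← huv, inv_mul_cancel_left]
  rwa [Near, this]

theorem finite_setOf_near (Y : Finset G) (n : ℕ) (g : G) : {h | Near Y n g h}.Finite :=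
  ((Y ^ n).finite_toSet).preimage (mul_right_injective g⁻¹).injOn

/-- Centers `B` of large cells and `L` of small cells: large cells are the translates of `Y ^ 4`
by `B`, small cells are the translates of `Y` by `L`. Distinct cells are separated by `Y`, and
both families are maximal. -/
structure IsCellSystem (Y : Finset G) (B L : Set G) : Prop where
  big_apart : ∀ c ∈ B, ∀ c' ∈ B, Near Y 9 c c' → c = c'
  big_dense : ∀ g, ∃ c, Near Y 9 g c ∧ c ∈ B
  small_apart : ∀ l ∈ L, ∀ l' ∈ L, Near Y 3 l l' → l = l'
  small_big : ∀ l ∈ L, ∀ c ∈ B, ¬ Near Y 6 l c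
  covers : ∀ g, (∃ l, Near Y 3 g l ∧ l ∈ L) ∨ ∃ c, Near Y 6 g c ∧ c ∈ B

/-- `t` is obtained by copying `s` into every cell, and is zero outside the cells. -/
def FillsCells (Y : Finset G) (s : G → Fin 2) (B L : Set G) (t : G → Fin 2) : Prop :=
  ∀ a, t a = 1 ↔ (∃ c, Near Y 4 a c ∧ c ∈ B ∧ s (c⁻¹ * a) = 1) ∨
    ∃ l, Near Y 1 a l ∧ l ∈ L ∧ s (l⁻¹ * a) = 1

theorem exists_isCellSystem {Y : Finset G} (h1 : (1 : G) ∈ Y) (hY : ∀ y ∈ Y, y⁻¹ ∈ Y)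
    (B₀ L₀ : Set G) (hB : ∀ c ∈ B₀, ∀ c' ∈ B₀, Near Y 9 c c' → c = c')
    (hL : ∀ l ∈ L₀, ∀ l' ∈ L₀, Near Y 3 l l' → l = l')
    (hLB : ∀ l ∈ L₀, ∀ c ∈ B₀, ¬ Near Y 6 l c)
    (hdense : ∀ l ∈ L₀, ∀ c, Near Y 6 l c → ∃ c₀ ∈ B₀, Near Y 9 c c₀) :
    ∃ B L, B₀ ⊆ B ∧ L₀ ⊆ L ∧ IsCellSystem Y B L := by
  obtain ⟨B, hB₀B, -, hBa, hBd⟩ := exists_maximal_independent (Near Y 9) (Near.refl h1 9)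
    (fun _ _ => Near.symm hY) Set.univ B₀ (Set.subset_univ _) hB
  obtain ⟨L, hL₀L, hLA, hLa, hLd⟩ := exists_maximal_independent (Near Y 3) (Near.refl h1 3)
    (fun _ _ => Near.symm hY) {g | ∀ c ∈ B, ¬ Near Y 6 g c} L₀ (fun l hl c hc hlc => by
      obtain ⟨c₀, hc₀, hcc₀⟩ := hdense l hl c hlc
      obtain rfl := hBa c hc c₀ (hB₀B hc₀) hcc₀
      exact hLB l hl c hc₀ hlc) hL
  refine ⟨B, L, hB₀B, hL₀L, hBa, fun g => ?_, hLa, fun l hl => hLA hl, fun g => ?_⟩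
  · obtain ⟨c, hc, hgc⟩ := hBd g trivial
    exact ⟨c, hgc, hc⟩
  · by_cases hg : ∀ c ∈ B, ¬ Near Y 6 g c
    · obtain ⟨l, hl, hgl⟩ := hLd g hg
      exact Or.inl ⟨l, hgl, hl⟩
    · push Not at hg
      obtain ⟨c, hc, hgc⟩ := hg
      exact Or.inr ⟨c, hgc, hc⟩

theorem exists_fillsCells (Y : Finset G) (s : G → Fin 2) (B L : Set G) :
    ∃ t, FillsCells Y s B L t := by
  classical
  exact ⟨fun a => if (∃ c, Near Y 4 a c ∧ c ∈ B ∧ s (c⁻¹ * a) = 1) ∨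
    (∃ l, Near Y 1 a l ∧ l ∈ L ∧ s (l⁻¹ * a) = 1) then 1 else 0, fun a => by
    simp only [ite_eq_left_iff, zero_ne_one, imp_false, not_not]⟩

/-- A cell system containing all the nearby cells of another one has the same cells locally. -/
theorem FillsCells.eq_of_subset {Y : Finset G} (h1 : (1 : G) ∈ Y) {s t t₁ : G → Fin 2} {B L B₁ L₁ : Set G} (h : IsCellSystem Y B L)
    (h₁ : IsCellSystem Y B₁ L₁) (ht : FillsCells Y s B L t) (ht₁ : FillsCells Y s B₁ L₁ t₁)
    {a : G} (hB : ∀ c ∈ B₁, Near Y 19 a c → c ∈ B) (hL : ∀ l ∈ L₁, Near Y 4 a l → l ∈ L) :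
    t a = t₁ a := by
  have key : t a = 1 ↔ t₁ a = 1 := by
    rw [ht a, ht₁ a]
    constructor
    · rintro (⟨c, hac, hc, hs⟩ | ⟨l, hal, hl, hs⟩)
      · obtain ⟨c₁, hcc₁, hc₁⟩ := h₁.big_dense c
        obtain rfl := h.big_apart c hc c₁ (hB c₁ hc₁ ((hac.trans hcc₁).mono h1 (by norm_num))) hcc₁
        exact Or.inl ⟨c, hac, hc₁, hs⟩
      · rcases h₁.covers l with ⟨l₁, hll₁, hl₁⟩ | ⟨c₁, hlc₁, hc₁⟩
        · obtain rfl := h.small_apart l hl l₁ (hL l₁ hl₁ (hal.trans hll₁)) hll₁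
          exact Or.inr ⟨l, hal, hl₁, hs⟩
        · exact absurd hlc₁ (h.small_big l hl c₁
            (hB c₁ hc₁ ((hal.trans hlc₁).mono h1 (by norm_num))))
    · rintro (⟨c, hac, hc, hs⟩ | ⟨l, hal, hl, hs⟩)
      · exact Or.inl ⟨c, hac, hB c hc (hac.mono h1 (by norm_num)), hs⟩
      · exact Or.inr ⟨l, hal, hL l hl (hal.mono h1 (by norm_num)), hs⟩
  omega

theorem IsCellSystem.exists_glue {Y : Finset G} (h1 : (1 : G) ∈ Y) (hY : ∀ y ∈ Y, y⁻¹ ∈ Y)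
    {B₁ L₁ B₂ L₂ : Set G} (h₁ : IsCellSystem Y B₁ L₁) (h₂ : IsCellSystem Y B₂ L₂)
    {E₁ E₂ : Set G} {n : ℕ} (hn : 60 ≤ n)
    (hE : ∀ a ∈ E₁, ∀ b ∈ E₂, ¬ Near Y n a b) :
    ∃ B L, IsCellSystem Y B L ∧
      (∀ a ∈ E₁, (∀ c ∈ B₁, Near Y 19 a c → c ∈ B) ∧ ∀ l ∈ L₁, Near Y 4 a l → l ∈ L) ∧
      ∀ a ∈ E₂, (∀ c ∈ B₂, Near Y 19 a c → c ∈ B) ∧ ∀ l ∈ L₂, Near Y 4 a l → l ∈ L := by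
  have far : ∀ {i j k : ℕ} {a b c d : G}, a ∈ E₁ → Near Y i a c → Near Y j c d → b ∈ E₂ →
      Near Y k b d → i + j + k ≤ 60 → False := fun ha hac hcd hb hbd hle =>
    hE _ ha _ hb (((hac.trans hcd).trans (hbd.symm hY)).mono h1 (hle.trans hn))
  obtain ⟨B, L, hB, hL, h⟩ := exists_isCellSystem h1 hY
    ({c | c ∈ B₁ ∧ ∃ a ∈ E₁, Near Y 19 a c} ∪ {c | c ∈ B₂ ∧ ∃ a ∈ E₂, Near Y 19 a c})
    ({l | l ∈ L₁ ∧ ∃ a ∈ E₁, Near Y 4 a l} ∪ {l | l ∈ L₂ ∧ ∃ a ∈ E₂, Near Y 4 a l})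
    (by
      rintro c (⟨hc, a, ha, hac⟩ | ⟨hc, a, ha, hac⟩) c' (⟨hc', b, hb, hbc⟩ | ⟨hc', b, hb, hbc⟩) hcc
      · exact h₁.big_apart c hc c' hc' hcc
      · exact (far ha hac hcc hb hbc (by norm_num)).elim
      · exact (far hb hbc (hcc.symm hY) ha hac (by norm_num)).elim
      · exact h₂.big_apart c hc c' hc' hcc)
    (by
      rintro c (⟨hc, a, ha, hac⟩ | ⟨hc, a, ha, hac⟩) c' (⟨hc', b, hb, hbc⟩ | ⟨hc', b, hb, hbc⟩) hcc
      · exact h₁.small_apart c hc c' hc' hcc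
      · exact (far ha hac hcc hb hbc (by norm_num)).elim
      · exact (far hb hbc (hcc.symm hY) ha hac (by norm_num)).elim
      · exact h₂.small_apart c hc c' hc' hcc)
    (by
      rintro c (⟨hc, a, ha, hac⟩ | ⟨hc, a, ha, hac⟩) c' (⟨hc', b, hb, hbc⟩ | ⟨hc', b, hb, hbc⟩) hcc
      · exact h₁.small_big c hc c' hc' hcc
      · exact (far ha hac hcc hb hbc (by norm_num)).elim
      · exact (far hb hbc (hcc.symm hY) ha hac (by norm_num)).elim
      · exact h₂.small_big c hc c' hc' hcc)
    (by
      rintro l (⟨hl, a, ha, hal⟩ | ⟨hl, a, ha, hal⟩) c hlc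
      · obtain ⟨c₀, hcc₀, hc₀⟩ := h₁.big_dense c
        exact ⟨c₀, Or.inl ⟨hc₀, a, ha, ((hal.trans hlc).trans hcc₀).mono h1 (by norm_num)⟩, hcc₀⟩
      · obtain ⟨c₀, hcc₀, hc₀⟩ := h₂.big_dense c
        exact ⟨c₀, Or.inr ⟨hc₀, a, ha, ((hal.trans hlc).trans hcc₀).mono h1 (by norm_num)⟩, hcc₀⟩)
  exact ⟨B, L, h,
    fun a ha => ⟨fun c hc hac => hB (Or.inl ⟨hc, a, ha, hac⟩),
      fun l hl hal => hL (Or.inl ⟨hl, a, ha, hal⟩)⟩,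
    fun a ha => ⟨fun c hc hac => hB (Or.inr ⟨hc, a, ha, hac⟩),
      fun l hl hal => hL (Or.inr ⟨hl, a, ha, hal⟩)⟩⟩

theorem near_mul_left_iff (Y : Finset G) (n : ℕ) (g a b : G) :
    Near Y n (g * a) (g * b) ↔ Near Y n a b := by
  simp [Near, mul_assoc]

theorem IsCellSystem.translate {Y : Finset G} {B L : Set G} (h : IsCellSystem Y B L) (g : G) :
    IsCellSystem Y {a | g⁻¹ * a ∈ B} {a | g⁻¹ * a ∈ L} where
  big_apart c hc c' hc' hcc := mul_left_cancel
    (h.big_apart _ hc _ hc' ((near_mul_left_iff Y 9 g⁻¹ c c').2 hcc))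
  big_dense a := by
    obtain ⟨c, hac, hc⟩ := h.big_dense (g⁻¹ * a)
    exact ⟨g * c, by rw [← near_mul_left_iff Y 9 g⁻¹]; simpa using hac, by simpa using hc⟩
  small_apart c hc c' hc' hcc := mul_left_cancel
    (h.small_apart _ hc _ hc' ((near_mul_left_iff Y 3 g⁻¹ c c').2 hcc))
  small_big l hl c hc hlc := h.small_big _ hl _ hc ((near_mul_left_iff Y 6 g⁻¹ l c).2 hlc)
  covers a := by
    rcases h.covers (g⁻¹ * a) with ⟨c, hac, hc⟩ | ⟨c, hac, hc⟩
    · exact Or.inl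
        ⟨g * c, by rw [← near_mul_left_iff Y 3 g⁻¹]; simpa using hac, by simpa using hc⟩
    · exact Or.inr
        ⟨g * c, by rw [← near_mul_left_iff Y 6 g⁻¹]; simpa using hac, by simpa using hc⟩

theorem FillsCells.translate {Y : Finset G} {s t : G → Fin 2} {B L : Set G}
    (h : FillsCells Y s B L t) (g : G) :
    FillsCells Y s {a | g⁻¹ * a ∈ B} {a | g⁻¹ * a ∈ L} (shiftAct g t) := by
  have aux : ∀ (n : ℕ) (C : Set G) (a : G),
      (∃ c, Near Y n (g⁻¹ * a) c ∧ c ∈ C ∧ s (c⁻¹ * (g⁻¹ * a)) = 1) ↔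
        ∃ c, Near Y n a c ∧ g⁻¹ * c ∈ C ∧ s (c⁻¹ * a) = 1 := by
    intro n C a
    rw [← (Equiv.mulLeft g⁻¹).exists_congr_right]
    simp only [Equiv.coe_mulLeft, near_mul_left_iff]
    simp [mul_assoc]
  intro a
  rw [shiftAct, h (g⁻¹ * a), aux, aux]
  rfl

theorem isClosed_setOf_cells (Y : Finset G) (s : G → Fin 2) :
    IsClosed {t | ∃ B L : Set G, IsCellSystem Y B L ∧ FillsCells Y s B L t} := by
  let K : Set ((G → Bool × Bool) × (G → Fin 2)) := {x |
    IsCellSystem Y {g | (x.1 g).1 = true} {g | (x.1 g).2 = true} ∧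
      FillsCells Y s {g | (x.1 g).1 = true} {g | (x.1 g).2 = true} x.2}
  have hbig : ∀ g, IsClopen {x : (G → Bool × Bool) × (G → Fin 2) | (x.1 g).1 = true} := fun g =>
    (isClopen_discrete {true}).preimage (by fun_prop)
  have hsmall : ∀ g, IsClopen {x : (G → Bool × Bool) × (G → Fin 2) | (x.1 g).2 = true} := fun g =>
    (isClopen_discrete {true}).preimage (by fun_prop)
  have hval : ∀ g, IsClopen {x : (G → Bool × Bool) × (G → Fin 2) | x.2 g = 1} := fun g =>
    (isClopen_discrete {1}).preimage (by fun_prop)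
  have hex : ∀ (n : ℕ) (a : G) (Q : G → (G → Bool × Bool) × (G → Fin 2) → Prop),
      (∀ c, IsClopen {x | Q c x}) → IsClopen {x | ∃ c, Near Y n a c ∧ Q c x} := by
    intro n a Q hQ
    have : {x | ∃ c, Near Y n a c ∧ Q c x} = ⋃ c ∈ {c | Near Y n a c}, {x | Q c x} := by
      ext x
      simp
    rw [this]
    exact (finite_setOf_near Y n a).isClopen_biUnion fun c _ => hQ c
  have hconst : ∀ q : Prop, IsClopen {_x : (G → Bool × Bool) × (G → Fin 2) | q} := fun q => by
    by_cases hq : q <;> simp [hq, isClopen_univ, isClopen_empty]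
  have hand : ∀ {p q : (G → Bool × Bool) × (G → Fin 2) → Prop}, IsClopen {x | p x} →
      IsClopen {x | q x} → IsClopen {x | p x ∧ q x} := fun hp hq => hp.inter hq
  have hor : ∀ {p q : (G → Bool × Bool) × (G → Fin 2) → Prop}, IsClopen {x | p x} →
      IsClopen {x | q x} → IsClopen {x | p x ∨ q x} := fun hp hq => hp.union hq
  have himp : ∀ {p q : (G → Bool × Bool) × (G → Fin 2) → Prop}, IsClopen {x | p x} →
      IsClopen {x | q x} → IsClopen {x | p x → q x} := fun hp hq => by
    simp only [imp_iff_not_or]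
    exact hor hp.compl hq
  have hall : ∀ {Q : G → (G → Bool × Bool) × (G → Fin 2) → Prop},
      (∀ c, IsClosed {x | Q c x}) → IsClosed {x | ∀ c, Q c x} := fun hQ => by
    simpa only [Set.ofPred_forall] using isClosed_iInter hQ
  have hK : IsClosed K := by
    have : K = {x | (∀ c c', (x.1 c).1 = true → (x.1 c').1 = true → Near Y 9 c c' → c = c')} ∩
        {x | ∀ g, ∃ c, Near Y 9 g c ∧ (x.1 c).1 = true} ∩
        {x | ∀ l l', (x.1 l).2 = true → (x.1 l').2 = true → Near Y 3 l l' → l = l'} ∩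
        {x | ∀ l c, (x.1 l).2 = true → (x.1 c).1 = true → ¬ Near Y 6 l c} ∩
        {x | ∀ g, (∃ l, Near Y 3 g l ∧ (x.1 l).2 = true) ∨
          ∃ c, Near Y 6 g c ∧ (x.1 c).1 = true} ∩
        ({x | ∀ a, x.2 a = 1 → ((∃ c, Near Y 4 a c ∧ (x.1 c).1 = true ∧ s (c⁻¹ * a) = 1) ∨
          ∃ l, Near Y 1 a l ∧ (x.1 l).2 = true ∧ s (l⁻¹ * a) = 1)} ∩
        {x | ∀ a, ((∃ c, Near Y 4 a c ∧ (x.1 c).1 = true ∧ s (c⁻¹ * a) = 1) ∨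
          ∃ l, Near Y 1 a l ∧ (x.1 l).2 = true ∧ s (l⁻¹ * a) = 1) → x.2 a = 1}) := by
      ext x
      constructor
      · rintro ⟨⟨p1, p2, p3, p4, p5⟩, hf⟩
        exact ⟨⟨⟨⟨⟨fun c c' hc hc' => p1 c hc c' hc', p2⟩, fun c c' hc hc' => p3 c hc c' hc'⟩,
          fun c c' hc hc' => p4 c hc c' hc'⟩, p5⟩, fun a => (hf a).1, fun a => (hf a).2⟩
      · rintro ⟨⟨⟨⟨⟨p1, p2⟩, p3⟩, p4⟩, p5⟩, hf, hf'⟩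
        exact ⟨⟨fun c hc c' hc' => p1 c c' hc hc', p2, fun c hc c' hc' => p3 c c' hc hc',
          fun c hc c' hc' => p4 c c' hc hc', p5⟩, fun a => ⟨hf a, hf' a⟩⟩
    have hfill : ∀ a, IsClopen {x : (G → Bool × Bool) × (G → Fin 2) |
        (∃ c, Near Y 4 a c ∧ (x.1 c).1 = true ∧ s (c⁻¹ * a) = 1) ∨
          ∃ l, Near Y 1 a l ∧ (x.1 l).2 = true ∧ s (l⁻¹ * a) = 1} := fun a =>
      hor (hex 4 a _ fun c => hand (hbig c) (hconst _))
        (hex 1 a _ fun l => hand (hsmall l) (hconst _))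
    rw [this]
    refine (((((IsClosed.inter ?_ ?_).inter ?_).inter ?_).inter ?_).inter (IsClosed.inter ?_ ?_))
    · exact hall fun c => hall fun c' =>
        (himp (hbig c) (himp (hbig c') (hconst (Near Y 9 c c' → c = c')))).isClosed
    · exact hall fun g => (hex 9 g _ hbig).isClosed
    · exact hall fun c => hall fun c' =>
        (himp (hsmall c) (himp (hsmall c') (hconst (Near Y 3 c c' → c = c')))).isClosed
    · exact hall fun l => hall fun c =>
        (himp (hsmall l) (himp (hbig c) (hconst (¬ Near Y 6 l c)))).isClosed
    · exact hall fun g => (hor (hex 3 g _ hsmall) (hex 6 g _ hbig)).isClosed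
    · exact hall fun a => (himp (hval a) (hfill a)).isClosed
    · exact hall fun a => (himp (hfill a) (hval a)).isClosed
  convert isClosedMap_snd_of_compactSpace K hK using 1
  ext t
  constructor
  · rintro ⟨B, L, h⟩
    classical
    exact ⟨(fun g => (decide (g ∈ B), decide (g ∈ L)), t), by simpa [K] using h, rfl⟩
  · rintro ⟨x, hx, rfl⟩
    exact ⟨_, _, hx⟩

theorem FillsCells.apart {Y : Finset G} (hY : ∀ y ∈ Y, y⁻¹ ∈ Y)
    {X : Finset G} (hXY : X ⊆ Y) {s t : G → Fin 2}
    (hs : ∀ a b : G, s a = 1 → s b = 1 → a ≠ b → XApart X a b)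
    {B L : Set G} (h : IsCellSystem Y B L) (ht : FillsCells Y s B L t)
    {a b : G} (ha : t a = 1) (hb : t b = 1) (hab : a ≠ b) : XApart X a b := by
  have same : ∀ c, s (c⁻¹ * a) = 1 → s (c⁻¹ * b) = 1 → XApart X a b := fun c hsa hsb => by
    simpa [XApart, mul_assoc] using hs _ _ hsa hsb (by simpa using hab)
  intro hX
  have hn : Near Y 1 a b := by simpa [Near] using hXY hX
  rcases (ht a).1 ha with ⟨c, hac, hc, hsa⟩ | ⟨c, hac, hc, hsa⟩ <;>
    rcases (ht b).1 hb with ⟨c', hbc, hc', hsb⟩ | ⟨c', hbc, hc', hsb⟩ <;>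
    have hcc := ((hac.symm hY).trans hn).trans hbc
  · obtain rfl := h.big_apart c hc c' hc' hcc
    exact same c hsa hsb hX
  · exact h.small_big c' hc' c hc (hcc.symm hY)
  · exact h.small_big c hc c' hc' hcc
  · obtain rfl := h.small_apart c hc c' hc' hcc
    exact same c hsa hsb hX

theorem FillsCells.exists_common {Y : Finset G} (h1 : (1 : G) ∈ Y) (hY : ∀ y ∈ Y, y⁻¹ ∈ Y)
    {s t t' : G → Fin 2} {N : ℕ} (hN : 3 ≤ N)
    (hs : ∀ g ∈ Y ^ N, ∀ h ∈ Y ^ N, ∃ a ∈ Y, s (g * a) = 1 ∧ s (h * a) = 1)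
    {B L B' L' : Set G} (h : IsCellSystem Y B L) (ht : FillsCells Y s B L t)
    (h' : IsCellSystem Y B' L') (ht' : FillsCells Y s B' L' t') :
    ∃ a, t a = 1 ∧ t' a = 1 := by
  have meet : ∀ {m n : ℕ} {c c' z : G}, Near Y m c z → Near Y n c' z → m ≤ N → n ≤ N →
      ∃ a, Near Y (1 + m) a c ∧ Near Y (1 + n) a c' ∧ s (c⁻¹ * a) = 1 ∧ s (c'⁻¹ * a) = 1 := by
    intro m n c c' z hcz hcz' hm hn
    obtain ⟨a, ha, hsa, hsa'⟩ := hs _ (hcz.mono h1 hm) _ (hcz'.mono h1 hn)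
    have hza : Near Y 1 (z * a) z := Near.symm hY (by simpa [Near] using ha)
    exact ⟨z * a, hza.trans (hcz.symm hY), hza.trans (hcz'.symm hY),
      by simpa [mul_assoc] using hsa, by simpa [mul_assoc] using hsa'⟩
  obtain ⟨c, -, hc⟩ := h.big_dense 1
  rcases h'.covers c with ⟨l, hcl, hl⟩ | ⟨c', hcc, hc'⟩
  · obtain ⟨a, hac, hal, hsc, hsl⟩ := meet hcl (Near.refl h1 0 l) hN (Nat.zero_le N)
    exact ⟨a, (ht a).2 (Or.inl ⟨c, hac, hc, hsc⟩), (ht' a).2 (Or.inr ⟨l, hal, hl, hsl⟩)⟩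
  · obtain ⟨z, hcz, hzc⟩ := Near.exists_between (m := 3) (n := 3) hcc
    obtain ⟨a, hac, hac', hsc, hsc'⟩ := meet hcz (hzc.symm hY) hN hN
    exact ⟨a, (ht a).2 (Or.inl ⟨c, hac, hc, hsc⟩), (ht' a).2 (Or.inl ⟨c', hac', hc', hsc'⟩)⟩

end Cells

/-- Let `G` be a countable group such that for every finite symmetric `X ⊆ G` containing the
identity there are a configuration `s ∈ 2^G` and a finite symmetric `Y ⊇ X` satisfying the
conclusion of Proposition 2.4 of the paper.  Then for every finite symmetric `X ⊆ G`
containing the identity there is a strongly irreducible `X`-witness shift `S ⊆ 2^G`. -/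
theorem exists_stronglyIrreducible_witness_shift_of_witness_configurations
    (G : Type) [Group G] [Countable G] [DecidableEq G]
    (hyp : ∀ X : Finset G, (∀ x ∈ X, x⁻¹ ∈ X) → (1 : G) ∈ X →
      ∃ (s : G → Fin 2) (Y : Finset G),
        X ⊆ Y ∧ (∀ y ∈ Y, y⁻¹ ∈ Y) ∧
        (∀ a b : G, s a = 1 → s b = 1 → a ≠ b → XApart X a b) ∧
        (∀ g ∈ Y ^ (100 : ℕ), ∀ h ∈ Y ^ (100 : ℕ),
          ∃ a ∈ Y, s (g * a) = 1 ∧ s (h * a) = 1)) :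
    ∀ X : Finset G, (∀ x ∈ X, x⁻¹ ∈ X) → (1 : G) ∈ X →
      ∃ S : Set (G → Fin 2), IsShift S ∧ StronglyIrreducible S ∧ IsWitnessShift X S := by
  obtain ⟨N, hN⟩ : ∃ N, N = 100 := ⟨_, rfl⟩
  rw [← hN] at hyp
  intro X hX h1X
  obtain ⟨s, Y, hXY, hY, hsX, hs⟩ := hyp X hX h1X
  have h1 : (1 : G) ∈ Y := hXY h1X
  refine ⟨{t | ∃ B L : Set G, IsCellSystem Y B L ∧ FillsCells Y s B L t},
    ⟨?_, isClosed_setOf_cells Y s, ?_⟩, ⟨Y ^ N, Finset.one_mem_pow h1, ?_⟩, ?_, ?_⟩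
  · obtain ⟨B, L, -, -, h⟩ := exists_isCellSystem h1 hY ∅ ∅ (by simp) (by simp) (by simp) (by simp)
    obtain ⟨t, ht⟩ := exists_fillsCells Y s B L
    exact ⟨t, B, L, h, ht⟩
  · rintro t ⟨B, L, h, ht⟩ g
    exact ⟨_, _, h.translate g, ht.translate g⟩
  · rintro E₁ E₂ hE t₁ ⟨B₁, L₁, h₁, ht₁⟩ t₂ ⟨B₂, L₂, h₂, ht₂⟩
    have hfar : ∀ a ∈ E₁, ∀ b ∈ E₂, ¬ Near Y (N + N) a b := by
      intro a ha b hb hab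
      obtain ⟨z, haz, hzb⟩ := Near.exists_between hab
      have hz : z ∈ (E₁ * ((Y ^ N : Finset G) : Set G)) ∩ (E₂ * ((Y ^ N : Finset G) : Set G)) :=
        ⟨⟨a, ha, a⁻¹ * z, haz, mul_inv_cancel_left a z⟩,
          ⟨b, hb, b⁻¹ * z, hzb.symm hY, mul_inv_cancel_left b z⟩⟩
      rw [hE] at hz
      exact hz
    obtain ⟨B, L, h, hE₁, hE₂⟩ := h₁.exists_glue h1 hY h₂ (by omega) hfar
    obtain ⟨t, ht⟩ := exists_fillsCells Y s B L
    exact ⟨t, ⟨B, L, h, ht⟩,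
      fun a ha => ht.eq_of_subset h1 h h₁ ht₁ (hE₁ a ha).1 (hE₁ a ha).2,
      fun a ha => ht.eq_of_subset h1 h h₂ ht₂ (hE₂ a ha).1 (hE₂ a ha).2⟩
  · rintro t ⟨B, L, h, ht⟩ a b ha hb hab
    exact ht.apart hY hXY hsX h ha hb hab
  · rintro t ⟨B, L, h, ht⟩ t' ⟨B', L', h', ht'⟩
    exact ht.exists_common h1 hY (by omega) hs h h' ht'
end
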